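/- Suppose the system is highly non-singular and s > 2s_0, where s_0 = Σ_{h=1}^{t} (μ_h − μ_{h+1}) u_h for some positive integers u_h satisfying u_h ≥ (k/2)(1 + ϖ_h) for 1 ≤ h ≤ t. Then the singular series 𝔖 = Σ_{q=1}^{∞} Σ_{1 ≤ a ≤ q, gcd(q,a_1,…,a_r)=1} Π_{j=1}^{s} q^{−1} S_j(q,a) converges absolutely, and there exist δ > 0 and a constant C with |𝔖 − 𝔖(X)| ≤ C X^{−δ} for all X ≥ 1. -/

import Mathlib

open MeasureTheory Filter Finset
open scoped Classical

noncomputable section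

/-- `e(θ) = exp(2πiθ)`. -/
def eC (θ : ℝ) : ℂ := Complex.exp (2 * Real.pi * Complex.I * θ)

/-- Index pairs `(l, n)` for the distinct exponents `k_{l,n}`. -/
abbrev KIdx (t : ℕ) (ν : Fin t → ℕ) := Σ l : Fin t, Fin (ν l)

/-- Equation indices `(l, n, m)`: the `μ_l` equations of exponent `k_{l,n}`
(the interval `𝓘_{l,n}`). -/
abbrev EqIdx (t : ℕ) (ν μ : Fin t → ℕ) := Σ l : Fin t, Fin (ν l) × Fin (μ l)

variable (t : ℕ) (ν μ : Fin t → ℕ) (k : (l : Fin t) → Fin (ν l) → ℕ)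

/-- The degree `d_i` of equation `i`. -/
def deg (i : EqIdx t ν μ) : ℕ := k i.1 i.2.1

/-- `μ_h` for `1 ≤ h ≤ t` (`1`-based), with the convention `μ_{t+1} = 0`. -/
def mu1 (h : ℕ) : ℕ := if hh : 1 ≤ h ∧ h ≤ t then μ ⟨h - 1, by omega⟩ else 0

/-- `ϖ_h = ν(1) + ⋯ + ν(h)`. -/
def varpi (h : ℕ) : ℕ := ∑ l : Fin t, if (l : ℕ) < h then ν l else 0

/-- `K_1 + ⋯ + K_h`. -/
def Ksum (h : ℕ) : ℕ := ∑ p : KIdx t ν, if (p.1 : ℕ) < h then k p.1 p.2 else 0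

/-- The largest degree `k`. -/
def kmax : ℕ := Finset.univ.sup fun p : KIdx t ν => k p.1 p.2

/-- The total degree `K = d_1 + ⋯ + d_r`. -/
def Ktot : ℕ := ∑ i : EqIdx t ν μ, deg t ν μ k i

/-- The grouping hypotheses: `t ≥ 1`, all `ν l ≥ 1`, the multiplicities are
positive and strictly decreasing `μ_1 > ⋯ > μ_t`, and the exponents `k_{l,n}`
are positive and pairwise distinct. -/
def GroupedDegrees : Prop :=
  0 < t ∧ (∀ l, 0 < ν l) ∧ (∀ l, 0 < μ l) ∧ StrictAnti μ ∧
    (∀ l n, 0 < k l n) ∧ Function.Injective fun p : KIdx t ν => k p.1 p.2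

/-- `ℤ ∩ [1, P]` as a finite set. -/
def completeFS (P : ℝ) : Finset ℕ := Finset.Icc 1 ⌊P⌋₊

/-- `𝒜(P,R)`: the `R`-smooth numbers up to `P`. -/
def smoothFS (P R : ℝ) : Finset ℕ :=
  (Finset.Icc 1 ⌊P⌋₊).filter fun n => ∀ p : ℕ, p.Prime → p ∣ n → (p : ℝ) ≤ R

/-- The exponential sum `f_{𝐤_h}(γ; 𝒜) = Σ_{x ∈ 𝒜} e(Σ_{l ≤ h, n} γ_{l,n} x^{k_{l,n}})`. -/
def fA (A : Finset ℕ) (h : ℕ) (γ : KIdx t ν → ℝ) : ℂ :=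
  ∑ x ∈ A, eC (∑ p : KIdx t ν, if (p.1 : ℕ) < h then γ p * (x : ℝ) ^ (k p.1 p.2) else 0)

/-- The mean value `J_{u,𝐤_h}(𝒜)` (the coordinates `γ_{l,n}` with `l > h` are
dummy variables over the probability box, so this agrees with the
`ϖ_h`-dimensional integral). -/
def JA (A : Finset ℕ) (u h : ℕ) : ℝ :=
  ∫ γ in Set.univ.pi fun _ : KIdx t ν => Set.Ico (0 : ℝ) 1, ‖fA t ν k A h γ‖ ^ (2 * u)

variable (s : ℕ) (c : EqIdx t ν μ → Fin s → ℤ)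

/-- The system `Σ_j c_{ij} x_j^{d_i} = 0` is highly non-singular: all coefficients
are nonzero and every `μ_l × μ_l` minor taken from the rows `𝓘_{l,n}` is nonzero. -/
def HighlyNonSingular : Prop :=
  (∀ i j, c i j ≠ 0) ∧
  ∀ (l : Fin t) (n : Fin (ν l)) (J : Fin (μ l) → Fin s), Function.Injective J →
    (Matrix.of fun m m' : Fin (μ l) => c ⟨l, (n, m)⟩ (J m')).det ≠ 0

/-- `x` is a solution of the system, with coordinates in a commutative ring. -/
def IsSol {A : Type*} [CommRing A] (x : Fin s → A) : Prop :=
  ∀ i, ∑ j, (c i j : A) * x j ^ deg t ν μ k i = 0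

/-- The Jacobian `(d_i c_{ij} x_j^{d_i - 1})` has full rank `r` at `x`. -/
def JacFullRank {A : Type*} [CommRing A] (x : Fin s → A) : Prop :=
  (Matrix.of fun (i : EqIdx t ν μ) (j : Fin s) =>
      (deg t ν μ k i : A) * (c i j : A) * x j ^ (deg t ν μ k i - 1)).rank
    = Fintype.card (EqIdx t ν μ)

/-- The generalized exponential sum `f_j(α; 𝒜) = Σ_{x ∈ 𝒜} e(Σ_{l,n} γ_{j,l,n} x^{k_{l,n}})`,
where `γ_{j,l,n} = Σ_{i ∈ 𝓘_{l,n}} c_{ij} α_i`. -/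
def fj (A : Finset ℕ) (α : EqIdx t ν μ → ℝ) (j : Fin s) : ℂ :=
  ∑ x ∈ A, eC (∑ i : EqIdx t ν μ, (c i j : ℝ) * α i * (x : ℝ) ^ deg t ν μ k i)

end

noncomputable section

/-- The complete exponential sum
`S_j(q,a) = Σ_{x=1}^q e((Σ_{l,n} Λ_{j,l,n} x^{k_{l,n}})/q)` with
`Λ_{j,l,n} = Σ_{i ∈ 𝓘_{l,n}} c_{ij} a_i`. -/
def Sq (t : ℕ) (ν μ : Fin t → ℕ) (k : (l : Fin t) → Fin (ν l) → ℕ) (s : ℕ)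
    (c : EqIdx t ν μ → Fin s → ℤ) (q : ℕ) (a : EqIdx t ν μ → ℤ) (j : Fin s) : ℂ :=
  ∑ x ∈ Finset.Icc 1 q,
    eC ((∑ i : EqIdx t ν μ, (c i j : ℝ) * (a i : ℝ) * (x : ℝ) ^ deg t ν μ k i) / q)

/-- The set of `a` with `1 ≤ a_i ≤ q` and `gcd(q, a_1, …, a_r) = 1`. -/
def aSet (t : ℕ) (ν μ : Fin t → ℕ) (s : ℕ) (q : ℕ) : Finset (EqIdx t ν μ → ℤ) :=
  (Fintype.piFinset fun _ : EqIdx t ν μ => Finset.Icc (1 : ℤ) (q : ℤ)).filter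
    fun a => ∀ m : ℕ, ((m : ℤ) ∣ (q : ℤ) ∧ ∀ i, (m : ℤ) ∣ a i) → m = 1

/-- The `q`-th term `A(q) = Σ_{a} Π_j q⁻¹ S_j(q,a)` of the singular series. -/
def ssTerm (t : ℕ) (ν μ : Fin t → ℕ) (k : (l : Fin t) → Fin (ν l) → ℕ) (s : ℕ)
    (c : EqIdx t ν μ → Fin s → ℤ) (q : ℕ) : ℂ :=
  ∑ a ∈ aSet t ν μ s q, ∏ j : Fin s, ((q : ℂ))⁻¹ * Sq t ν μ k s c q a j

/-- The truncated singular series `𝔖(X)`. -/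
def ssTrunc (t : ℕ) (ν μ : Fin t → ℕ) (k : (l : Fin t) → Fin (ν l) → ℕ) (s : ℕ)
    (c : EqIdx t ν μ → Fin s → ℤ) (X : ℝ) : ℂ :=
  ∑ q ∈ Finset.Icc 1 ⌊X⌋₊, ssTerm t ν μ k s c q

section

open Polynomial

lemma eC_add (x y : ℝ) : eC (x + y) = eC x * eC y := by
  simp [eC, mul_add, Complex.exp_add]

lemma norm_eC (x : ℝ) : ‖eC x‖ = 1 := by
  rw [eC, show (2 * Real.pi * Complex.I * x : ℂ) = ((2 * Real.pi * x : ℝ) : ℂ) * Complex.I by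
    push_cast; ring]
  exact Complex.norm_exp_ofReal_mul_I _

lemma eC_intCast (n : ℤ) : eC n = 1 := by
  rw [eC, Complex.exp_eq_one_iff]
  exact ⟨n, by push_cast; ring⟩

lemma eC_eq_one_iff (x : ℝ) : eC x = 1 ↔ ∃ n : ℤ, x = n := by
  refine ⟨fun h => ?_, fun ⟨n, hn⟩ => hn ▸ eC_intCast n⟩
  rw [eC, Complex.exp_eq_one_iff] at h
  obtain ⟨n, hn⟩ := h
  refine ⟨n, ?_⟩
  have h2 : (2 * Real.pi * Complex.I : ℂ) ≠ 0 := Complex.two_pi_I_ne_zero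
  have h3 : (2 * Real.pi * Complex.I : ℂ) * x = (2 * Real.pi * Complex.I) * n := by
    rw [hn]; ring
  exact_mod_cast mul_left_cancel₀ h2 h3

lemma eC_div_eq_one_iff (q : ℕ) (hq : 0 < q) (n : ℤ) : eC ((n : ℝ) / q) = 1 ↔ (q : ℤ) ∣ n := by
  rw [eC_eq_one_iff]
  have : (q : ℝ) ≠ 0 := by positivity
  refine exists_congr fun m => ?_
  rw [div_eq_iff this]
  constructor
  · intro h; rw [mul_comm]; exact_mod_cast h
  · intro h; rw [h]; push_cast; ring

lemma eC_div_congr (q : ℕ) {m n : ℤ} (h : (q : ℤ) ∣ m - n) :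
    eC ((m : ℝ) / q) = eC ((n : ℝ) / q) := by
  rcases Nat.eq_zero_or_pos q with rfl | hq
  · simp
  rw [show (m : ℝ) / q = n / q + ((m - n : ℤ) : ℝ) / q by push_cast; ring, eC_add,
    (eC_div_eq_one_iff q hq _).2 h, mul_one]

/-- `F` has period `q`. -/
def PeriodicMod (q : ℕ) (F : ℤ → ℂ) : Prop := ∀ m n : ℤ, (q : ℤ) ∣ m - n → F m = F n

lemma sum_range_eq_sum_zmod {M : Type*} [AddCommMonoid M] (q : ℕ) [NeZero q] (F : ZMod q → M) :
    ∑ x ∈ range q, F (x : ℕ) = ∑ z : ZMod q, F z := by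
  refine Finset.sum_nbij' (fun x => (x : ZMod q)) (fun z => z.val) ?_ ?_ ?_ ?_ ?_
  · simp
  · intro z _; simpa using z.val_lt
  · intro x hx; exact ZMod.val_cast_of_lt (by simpa using hx)
  · intro z _; simp
  · simp

lemma PeriodicMod.eq_zmod {q : ℕ} [NeZero q] {F : ℤ → ℂ} (hF : PeriodicMod q F) (n : ℤ) :
    F n = F (((n : ZMod q).val : ℕ) : ℤ) := by
  apply hF
  rw [← ZMod.intCast_eq_intCast_iff_dvd_sub]
  simp

lemma PeriodicMod.sum_affine {q : ℕ} (hq : 0 < q) {F : ℤ → ℂ} (hF : PeriodicMod q F) (a b : ℤ)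
    (hb : IsCoprime b q) : ∑ y ∈ range q, F (a + b * y) = ∑ y ∈ range q, F y := by
  have : NeZero q := ⟨hq.ne'⟩
  have hu : IsUnit (b : ZMod q) := by
    obtain ⟨u, v, huv⟩ := hb
    refine IsUnit.of_mul_eq_one (u : ZMod q) ?_
    have := congrArg (Int.cast : ℤ → ZMod q) huv
    push_cast at this
    rw [mul_comm]; simpa using this
  set G : ZMod q → ℂ := fun z => F ((z.val : ℕ) : ℤ) with hG
  have h1 : ∀ y : ℕ, F (a + b * y) = G ((a : ZMod q) + b * (y : ℕ)) := by
    intro y; rw [hF.eq_zmod]; simp [hG]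
  have h2 : ∀ y : ℕ, F y = G (y : ℕ) := by
    intro y; rw [hF.eq_zmod]; simp only [hG, Int.cast_natCast]
  simp_rw [h1, h2]
  rw [sum_range_eq_sum_zmod q (fun z => G ((a : ZMod q) + b * z)), sum_range_eq_sum_zmod q G]
  obtain ⟨w, hw⟩ := hu
  rw [← hw]
  exact Equiv.sum_comp ((Units.mulLeft w).trans (Equiv.addLeft (a : ZMod q))) G

lemma sum_range_mul_split (F : ℤ → ℂ) (p q : ℕ) :
    ∑ x ∈ range (p * q), F x = ∑ m ∈ range p, ∑ y ∈ range q, F (m + p * y) := by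
  rcases Nat.eq_zero_or_pos p with rfl | hp
  · simp
  rw [← Finset.sum_product']
  refine Finset.sum_nbij' (fun x => (x % p, x / p)) (fun z => z.1 + p * z.2) ?_ ?_ ?_ ?_ ?_
  · intro x hx
    simp only [mem_range, mem_product] at *
    exact ⟨Nat.mod_lt _ hp, Nat.div_lt_of_lt_mul hx⟩
  · intro z hz
    simp only [mem_range, mem_product] at *
    calc z.1 + p * z.2 < p + p * z.2 := by omega
      _ = p * (z.2 + 1) := by ring
      _ ≤ p * q := Nat.mul_le_mul_left _ hz.2
  · intro x _; exact Nat.mod_add_div x p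
  · intro z hz
    simp only [mem_range, mem_product] at hz
    ext
    · simp [Nat.add_mul_mod_self_left, Nat.mod_eq_of_lt hz.1]
    · simp [Nat.add_mul_div_left _ _ hp, Nat.div_eq_of_lt hz.1]
  · intro x _
    congr 1
    exact_mod_cast (Nat.mod_add_div x p).symm

lemma PeriodicMod.sum_mul {q : ℕ} {F : ℤ → ℂ} (hF : PeriodicMod q F) (n : ℕ) :
    ∑ x ∈ range (n * q), F x = n * ∑ x ∈ range q, F x := by
  rw [mul_comm, sum_range_mul_split, Finset.mul_sum]
  refine Finset.sum_congr rfl fun m _ => ?_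
  rw [Finset.sum_congr rfl (g := fun _ => F m) fun y _ => hF _ _ ?_]
  · simp
  · simp


/-- The complete exponential sum of an integer polynomial modulo `q`. -/
def polySum (q : ℕ) (f : ℤ[X]) : ℂ := ∑ x ∈ range q, eC (((f.eval (x : ℤ) : ℤ) : ℝ) / q)

lemma periodicMod_eC_eval (q : ℕ) (f : ℤ[X]) :
    PeriodicMod q fun x => eC (((f.eval x : ℤ) : ℝ) / q) :=
  fun _ _ h => eC_div_congr q (h.trans (f.sub_dvd_eval_sub _ _))

lemma norm_polySum_le (q : ℕ) (f : ℤ[X]) : ‖polySum q f‖ ≤ q := by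
  refine (norm_sum_le _ _).trans ?_
  simp [norm_eC]

lemma polySum_mul (m n : ℕ) (hm : 0 < m) (hn : 0 < n) (h : Nat.Coprime m n) (f : ℤ[X]) :
    ∃ u v : ℤ, IsCoprime u m ∧ IsCoprime v n ∧
      polySum (m * n) f = polySum m (C u * f) * polySum n (C v * f) := by
  obtain ⟨v, u, huv⟩ := Nat.isCoprime_iff_coprime.2 h
  refine ⟨u, v, ⟨n, v, by linarith⟩, ⟨m, u, by linarith⟩, ?_⟩
  have hm' : (m : ℝ) ≠ 0 := by positivity
  have hn' : (n : ℝ) ≠ 0 := by positivity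
  have key : ∀ x : ℤ, eC (((f.eval x : ℤ) : ℝ) / (m * n : ℕ)) =
      eC ((((C u * f).eval x : ℤ) : ℝ) / m) * eC ((((C v * f).eval x : ℤ) : ℝ) / n) := by
    intro x
    rw [← eC_add]
    congr 1
    have : (v : ℝ) * m + u * n = 1 := by exact_mod_cast huv
    simp only [eval_mul, eval_C]
    push_cast
    field_simp
    linear_combination (-((f.eval x : ℤ) : ℝ)) * this
  have hp1 := periodicMod_eC_eval m (C u * f)
  have hp2 := periodicMod_eC_eval n (C v * f)
  rw [polySum, sum_range_mul_split (fun x => eC (((f.eval x : ℤ) : ℝ) / (m * n : ℕ)))]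
  rw [polySum, Finset.sum_mul]
  refine Finset.sum_congr rfl fun a _ => ?_
  simp_rw [key]
  have h1 : ∀ y : ℕ, eC ((((C u * f).eval (a + m * y : ℤ) : ℤ) : ℝ) / m) =
      eC ((((C u * f).eval (a : ℤ) : ℤ) : ℝ) / m) := fun y => hp1 _ _ (by simp)
  simp_rw [h1]
  rw [← Finset.mul_sum]
  congr 1
  exact hp2.sum_affine hn a m (Nat.isCoprime_iff_coprime.2 h)

/-- Over a field in which `1, …, k` are invertible, two `k`-tuples with the same first `k` power
sums have the same entries. -/
lemma exists_eq_of_power_sums_eq {F : Type*} [Field F] {k : ℕ}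
    (hk : ∀ n : ℕ, 0 < n → n ≤ k → (n : F) ≠ 0) (x y : Fin k → F)
    (h : ∀ i : Fin k, ∑ j, x j ^ (i.1 + 1) = ∑ j, y j ^ (i.1 + 1)) (j : Fin k) :
    ∃ j', x j = y j' := by
  have hp : ∀ n, 0 < n → n ≤ k → MvPolynomial.aeval x (MvPolynomial.psum (Fin k) F n) =
      MvPolynomial.aeval y (MvPolynomial.psum (Fin k) F n) := by
    intro n hn hnk
    have := h ⟨n - 1, by omega⟩
    simp only [Nat.sub_add_cancel hn] at this
    simpa [MvPolynomial.psum] using this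
  have he : ∀ n, n ≤ k → MvPolynomial.aeval x (MvPolynomial.esymm (Fin k) F n) =
      MvPolynomial.aeval y (MvPolynomial.esymm (Fin k) F n) := by
    intro n
    induction n using Nat.strong_induction_on with
    | _ n ih =>
      intro hnk
      rcases Nat.eq_zero_or_pos n with rfl | hn
      · simp
      · have h1 := congrArg (MvPolynomial.aeval x) (MvPolynomial.mul_esymm_eq_sum (Fin k) F n)
        have h2 := congrArg (MvPolynomial.aeval y) (MvPolynomial.mul_esymm_eq_sum (Fin k) F n)
        simp only [map_mul, map_natCast, map_pow, map_neg, map_one, map_sum] at h1 h2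
        apply mul_left_cancel₀ (hk n hn hnk)
        rw [h1, h2]
        congr 1
        refine Finset.sum_congr rfl fun a ha => ?_
        rw [mem_filter, HasAntidiagonal.mem_antidiagonal] at ha
        rw [ih a.1 ha.2 (by omega), hp a.2 (by omega) (by omega)]
  have hpoly : ∀ z : Fin k → F, (∏ i, (X - C (z i)) : F[X]) = ∑ j ∈ range (k + 1),
      (-1) ^ j * (C (MvPolynomial.aeval z (MvPolynomial.esymm (Fin k) F j)) * X ^ (k - j)) := by
    intro z
    have := Multiset.prod_X_sub_X_eq_sum_esymm (Finset.univ.val.map z)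
    simp only [Multiset.map_map, Multiset.card_map, Finset.card_val, Finset.card_univ,
      Fintype.card_fin] at this
    simp_rw [MvPolynomial.aeval_esymm_eq_multiset_esymm]
    exact this
  have hxy : (∏ i, (X - C (x i)) : F[X]) = ∏ i, (X - C (y i)) := by
    rw [hpoly, hpoly]
    refine Finset.sum_congr rfl fun n hn => ?_
    rw [he n (by simpa [Nat.lt_succ_iff] using hn)]
  have h0 := congrArg (eval (x j)) hxy
  simp only [eval_prod, eval_sub, eval_X, eval_C] at h0
  rw [Finset.prod_eq_zero (Finset.mem_univ j) (sub_self _)] at h0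
  obtain ⟨j', _, hj'⟩ := Finset.prod_eq_zero_iff.1 h0.symm
  exact ⟨j', sub_eq_zero.1 hj'⟩

/-- The number of tuples with prescribed first `k` power sums is at most `k ^ k`. -/
lemma card_power_sums_eq_le {F : Type*} [Field F] [Fintype F] {k : ℕ}
    (hk : ∀ n : ℕ, 0 < n → n ≤ k → (n : F) ≠ 0) (y : Fin k → F) :
    #{x : Fin k → F | ∀ i : Fin k, ∑ j, x j ^ (i.1 + 1) = ∑ j, y j ^ (i.1 + 1)} ≤ k ^ k := by
  calc _ ≤ #(Finset.univ.image fun τ : Fin k → Fin k => y ∘ τ) := by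
        refine Finset.card_le_card fun x hx => ?_
        rw [mem_filter] at hx
        choose τ hτ using exists_eq_of_power_sums_eq hk x y hx.2
        exact Finset.mem_image.2 ⟨τ, Finset.mem_univ _, funext fun j => (hτ j).symm⟩
    _ ≤ _ := Finset.card_image_le.trans (by simp)

lemma addChar_map_sum {A ι : Type*} [AddCommGroup A] (ψ : AddChar A ℂ) (t : Finset ι) (f : ι → A) :
    ψ (∑ i ∈ t, f i) = ∏ i ∈ t, ψ (f i) := by
  induction t using Finset.induction_on with
  | empty => simp
  | insert a t ha ih => rw [Finset.sum_insert ha, Finset.prod_insert ha, AddChar.map_add_eq_mul, ih]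

lemma sum_pi_addChar {F : Type*} [Field F] [Fintype F] {ψ : AddChar F ℂ} (hψ : ψ.IsPrimitive)
    {ι : Type*} [Fintype ι] [DecidableEq ι] (v : ι → F) :
    ∑ a : ι → F, ψ (∑ i, a i * v i) =
      if v = 0 then (Fintype.card F : ℂ) ^ Fintype.card ι else 0 := by
  have h1 : ∀ a : ι → F, ψ (∑ i, a i * v i) = ∏ i, ψ (a i * v i) := fun a => by
    rw [addChar_map_sum]
  simp_rw [h1]
  rw [← Fintype.prod_sum (fun i (z : F) => ψ (z * v i))]
  simp_rw [AddChar.sum_mulShift _ hψ]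
  split_ifs with h
  · subst h; simp
  · obtain ⟨i, hi⟩ := Function.ne_iff.1 h
    exact Finset.prod_eq_zero (Finset.mem_univ i) (by simpa using hi)

/-- The mean value of order `2k` of the complete exponential sums of degree `k`. -/
lemma sum_norm_pow_le {F : Type*} [Field F] [Fintype F] {ψ : AddChar F ℂ} (hψ : ψ.IsPrimitive)
    {k : ℕ} (hk : ∀ n : ℕ, 0 < n → n ≤ k → (n : F) ≠ 0) :
    ∑ a : Fin k → F, ‖∑ x : F, ψ (∑ i, a i * x ^ (i.1 + 1))‖ ^ (2 * k) ≤
      (k : ℝ) ^ k * (Fintype.card F : ℝ) ^ (2 * k) := by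
  set P : (Fin k → F) → Fin k → F := fun x i => ∑ j, x j ^ (i.1 + 1) with hP
  have hT : ∀ a : Fin k → F, (∑ x : F, ψ (∑ i, a i * x ^ (i.1 + 1))) ^ k =
      ∑ x : Fin k → F, ψ (∑ i, a i * P x i) := by
    intro a
    rw [Fintype.sum_pow]
    refine Finset.sum_congr rfl fun x _ => ?_
    rw [← addChar_map_sum]
    congr 1
    rw [Finset.sum_comm]
    simp [hP, Finset.mul_sum]
  have key : ((∑ a : Fin k → F, ‖∑ x : F, ψ (∑ i, a i * x ^ (i.1 + 1))‖ ^ (2 * k) : ℝ) : ℂ) =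
      ((∑ y : Fin k → F, ∑ x : Fin k → F,
        if P x = P y then (Fintype.card F : ℝ) ^ k else 0 : ℝ) : ℂ) := by
    have h2 : ∀ a : Fin k → F,
        ((‖∑ x : F, ψ (∑ i, a i * x ^ (i.1 + 1))‖ ^ (2 * k) : ℝ) : ℂ) =
        ∑ y : Fin k → F, ∑ x : Fin k → F, ψ (∑ i, a i * (P x i - P y i)) := by
      intro a
      rw [mul_comm 2 k, pow_mul, ← norm_pow, hT]
      push_cast
      rw [← Complex.mul_conj', map_sum, Finset.mul_sum]
      refine Finset.sum_congr rfl fun y _ => ?_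
      rw [Finset.sum_mul]
      refine Finset.sum_congr rfl fun x _ => ?_
      rw [← AddChar.map_neg_eq_conj, ← AddChar.map_add_eq_mul]
      congr 1
      rw [← sub_eq_add_neg, ← Finset.sum_sub_distrib]
      simp_rw [mul_sub]
    rw [Complex.ofReal_sum]
    simp_rw [h2]
    rw [Finset.sum_comm]
    push_cast
    refine Finset.sum_congr rfl fun y _ => ?_
    rw [Finset.sum_comm]
    refine Finset.sum_congr rfl fun x _ => ?_
    rw [sum_pi_addChar hψ (fun i => P x i - P y i)]
    have : (fun i => P x i - P y i) = 0 ↔ P x = P y := by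
      rw [← sub_eq_zero (a := P x)]; rfl
    simp only [this]
    split_ifs <;> simp
  rw [Complex.ofReal_inj.1 key]
  calc _ ≤ ∑ y : Fin k → F, (k : ℝ) ^ k * (Fintype.card F : ℝ) ^ k := by
        refine Finset.sum_le_sum fun y _ => ?_
        rw [← Finset.sum_filter, Finset.sum_const, nsmul_eq_mul]
        gcongr
        have := card_power_sums_eq_le hk y
        refine le_trans ?_ (by exact_mod_cast this : ((_ : ℕ) : ℝ) ≤ _)
        simp [hP, funext_iff]
    _ = _ := by
        simp; ring

lemma norm_sum_addChar_eval {F : Type*} [Field F] [Fintype F] (ψ : AddChar F ℂ) {k : ℕ} {g : F[X]}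
    (hg : g.natDegree ≤ k) :
    ‖∑ x : F, ψ (g.eval x)‖ = ‖∑ x : F, ψ (∑ i : Fin k, g.coeff (i.1 + 1) * x ^ (i.1 + 1))‖ := by
  have h1 : ∀ x : F, ψ (g.eval x) =
      ψ (g.coeff 0) * ψ (∑ i : Fin k, g.coeff (i.1 + 1) * x ^ (i.1 + 1)) := by
    intro x
    rw [← AddChar.map_add_eq_mul, eval_eq_sum_range' (Nat.lt_succ_of_le hg),
      Finset.sum_range_succ', ← Finset.sum_range (fun i => g.coeff (i + 1) * x ^ (i + 1)), add_comm]
    simp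
  simp_rw [h1]
  rw [← Finset.mul_sum, norm_mul, AddChar.norm_apply, one_mul]

/-- The polynomial `f(αX + β)`. -/
def affineComp {F : Type*} [CommRing F] (f : F[X]) (a b : F) : F[X] :=
  (taylor b f).comp (C a * X)

lemma eval_affineComp {F : Type*} [CommRing F] (f : F[X]) (a b x : F) :
    (affineComp f a b).eval x = f.eval (b + a * x) := by
  simp [affineComp, taylor_eval, add_comm]

lemma coeff_affineComp {F : Type*} [CommRing F] (f : F[X]) (a b : F) (n : ℕ) :
    (affineComp f a b).coeff n = (taylor b f).coeff n * a ^ n := by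
  rw [affineComp, comp_C_mul_X_coeff]

lemma natDegree_affineComp_le {F : Type*} [CommRing F] (f : F[X]) (a b : F) :
    (affineComp f a b).natDegree ≤ f.natDegree := by
  rw [natDegree_le_iff_coeff_eq_zero]
  intro n hn
  rw [coeff_affineComp, coeff_eq_zero_of_natDegree_lt (by rwa [natDegree_taylor]), zero_mul]

lemma coeff_taylor_pred {F : Type*} [CommRing F] (f : F[X]) {d : ℕ} (hf : f.natDegree = d + 1)
    (b : F) : (taylor b f).coeff d = f.coeff d + (d + 1 : ℕ) * f.coeff (d + 1) * b := by
  rw [taylor_coeff, hasseDeriv_apply, sum_over_range _ (by simp), hf, eval_finsetSum,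
    Finset.sum_range_succ, Finset.sum_range_succ, Finset.sum_eq_zero]
  · simp [mul_assoc]
  · intro i hi
    rw [Nat.choose_eq_zero_of_lt (by simpa using hi)]
    simp

/-- Mordell's bound, before dividing out. -/
lemma mordell_aux {F : Type*} [Field F] [Fintype F] {ψ : AddChar F ℂ} (hψ : ψ.IsPrimitive)
    {k : ℕ} (hk : ∀ n : ℕ, 0 < n → n ≤ k → (n : F) ≠ 0) {f : F[X]} (hf2 : 2 ≤ f.natDegree)
    (hfk : f.natDegree ≤ k) :
    ((Fintype.card F : ℝ) - 1) * Fintype.card F * ‖∑ x : F, ψ (f.eval x)‖ ^ (2 * k) ≤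
      k * ((k : ℝ) ^ k * (Fintype.card F : ℝ) ^ (2 * k)) := by
  obtain ⟨d, hd⟩ : ∃ d, f.natDegree = d + 1 := ⟨f.natDegree - 1, by omega⟩
  have hlead : f.coeff (d + 1) ≠ 0 := by
    rw [← hd]; simpa using (show f ≠ 0 by rintro rfl; simp at hd)
  set T : (Fin k → F) → ℝ := fun v => ‖∑ x : F, ψ (∑ i, v i * x ^ (i.1 + 1))‖ ^ (2 * k) with hT
  set Φ : F × F → Fin k → F := fun z i => (affineComp f z.1 z.2).coeff (i.1 + 1) with hΦ
  set A : Finset (F × F) := (Finset.univ.erase 0) ×ˢ Finset.univ with hA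
  have hAcard : (#A : ℝ) = ((Fintype.card F : ℝ) - 1) * Fintype.card F := by
    have : 1 ≤ Fintype.card F := Fintype.card_pos
    rw [hA, Finset.card_product, Finset.card_erase_of_mem (Finset.mem_univ _), Finset.card_univ]
    push_cast [this]
    ring
  have hS : ∀ z ∈ A, ‖∑ x : F, ψ (f.eval x)‖ ^ (2 * k) = T (Φ z) := by
    intro z hz
    have hz0 : z.1 ≠ 0 := by simpa [hA] using hz
    rw [hT, hΦ]
    dsimp only
    rw [← norm_sum_addChar_eval ψ ((natDegree_affineComp_le f z.1 z.2).trans hfk)]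
    congr 2
    simp_rw [eval_affineComp]
    exact (Equiv.sum_comp ((Equiv.mulLeft₀ z.1 hz0).trans (Equiv.addLeft z.2))
      fun x => ψ (f.eval x)).symm
  have hfib : ∀ v : Fin k → F, #{z ∈ A | Φ z = v} ≤ k := by
    intro v
    set c : F := v ⟨d, by omega⟩ / f.coeff (d + 1)
    have hlc : ∀ z ∈ A, Φ z = v → z.1 ^ (d + 1) = c := by
      intro z _ hv
      have h1 : f.coeff (d + 1) * z.1 ^ (d + 1) = v ⟨d, by omega⟩ := by
        rw [← hv, hΦ]
        dsimp only
        rw [coeff_affineComp]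
        congr 1
        have := leadingCoeff_taylor (f := f) z.2
        rw [leadingCoeff, leadingCoeff, natDegree_taylor, hd] at this
        exact this.symm
      rw [eq_div_iff hlead, mul_comm, h1]
    calc #{z ∈ A | Φ z = v} ≤ #((nthRoots (d + 1) c).toFinset) := by
          refine Finset.card_le_card_of_injOn Prod.fst ?_ ?_
          · intro z hz
            simp only [coe_filter, Set.mem_ofPred_eq] at hz
            simpa [mem_nthRoots (Nat.succ_pos d)] using hlc z hz.1 hz.2
          · intro z hz w hw hzw
            simp only [coe_filter, Set.mem_ofPred_eq] at hz hw
            have hz0 : z.1 ≠ 0 := by simpa [hA] using hz.1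
            refine Prod.ext hzw ?_
            have h2 := congrFun (hz.2.trans hw.2.symm) ⟨d - 1, by omega⟩
            rw [hΦ] at h2
            dsimp only at h2
            rw [Nat.sub_add_cancel (by omega), coeff_affineComp, coeff_affineComp, ← hzw,
              coeff_taylor_pred f hd, coeff_taylor_pred f hd] at h2
            have h3 := add_left_cancel (mul_right_cancel₀ (pow_ne_zero d hz0) h2)
            exact mul_left_cancel₀ (mul_ne_zero (hk _ (by omega) (by omega)) hlead) h3
      _ ≤ Multiset.card (nthRoots (d + 1) c) := Multiset.toFinset_card_le _
      _ ≤ d + 1 := card_nthRoots _ _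
      _ ≤ k := by omega
  calc _ = ∑ z ∈ A, T (Φ z) := by
        rw [← Finset.sum_congr rfl hS, Finset.sum_const, nsmul_eq_mul, hAcard]
    _ = ∑ v : Fin k → F, ∑ z ∈ A with Φ z = v, T (Φ z) :=
        (Finset.sum_fiberwise _ _ _).symm
    _ = ∑ v : Fin k → F, #{z ∈ A | Φ z = v} * T v := by
        refine Finset.sum_congr rfl fun v _ => ?_
        rw [← nsmul_eq_mul, ← Finset.sum_const]
        refine Finset.sum_congr rfl fun z hz => ?_
        rw [(Finset.mem_filter.1 hz).2]
    _ ≤ ∑ v : Fin k → F, k * T v := by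
        refine Finset.sum_le_sum fun v _ => ?_
        have : 0 ≤ T v := by positivity
        gcongr
        exact hfib v
    _ ≤ _ := by
        rw [← Finset.mul_sum]
        gcongr
        exact sum_norm_pow_le hψ hk

/-- **Mordell's bound** for complete exponential sums over a finite field. -/
lemma mordell {F : Type*} [Field F] [Fintype F] {ψ : AddChar F ℂ} (hψ : ψ.IsPrimitive)
    {k : ℕ} (hk : ∀ n : ℕ, 0 < n → n ≤ k → (n : F) ≠ 0) {f : F[X]} (hf1 : 1 ≤ f.natDegree)
    (hfk : f.natDegree ≤ k) :
    ‖∑ x : F, ψ (f.eval x)‖ ≤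
      2 * (k : ℝ) ^ (k + 1) * (Fintype.card F : ℝ) ^ (1 - 1 / (k : ℝ)) := by
  have hk1 : 1 ≤ k := hf1.trans hfk
  set N : ℝ := (Fintype.card F : ℝ) with hN
  have hN2 : 2 ≤ N := by
    have : 1 < Fintype.card F := Fintype.one_lt_card
    rw [hN]; exact_mod_cast this
  rcases hf1.eq_or_lt with h1 | h2
  · have h0 : ∑ x : F, ψ (f.eval x) = 0 := by
      have hlead : f.coeff 1 ≠ 0 := by
        rw [h1]; simpa using (show f ≠ 0 by rintro rfl; simp at h1)
      have : ∀ x, ψ (f.eval x) = ψ (f.coeff 0) * ψ (x * f.coeff 1) := by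
        intro x
        rw [← AddChar.map_add_eq_mul, eval_eq_sum_range, ← h1]
        simp [Finset.sum_range_succ, mul_comm]
      simp_rw [this]
      rw [← Finset.mul_sum, AddChar.sum_mulShift _ hψ, if_neg hlead]
      simp
    rw [h0, norm_zero]
    positivity
  · have haux := mordell_aux hψ hk h2 hfk
    rw [← hN] at haux
    set S := ‖∑ x : F, ψ (f.eval x)‖
    have hkR : (1 : ℝ) ≤ k := by exact_mod_cast hk1
    refine le_of_pow_le_pow_left₀ (n := 2 * k) (by omega) (by positivity) ?_
    have e1 : (N ^ (1 - 1 / (k : ℝ))) ^ (2 * k) = N ^ (2 * k) / N ^ 2 := by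
      rw [← Real.rpow_natCast, ← Real.rpow_mul (by linarith), eq_div_iff (by positivity),
        ← Real.rpow_natCast N 2, ← Real.rpow_add (by linarith), ← Real.rpow_natCast]
      congr 1
      push_cast
      field_simp
      ring
    rw [mul_pow, e1]
    have h3 : N ^ 2 / 2 * S ^ (2 * k) ≤ (k : ℝ) ^ (k + 1) * N ^ (2 * k) := by
      calc N ^ 2 / 2 * S ^ (2 * k) ≤ (N - 1) * N * S ^ (2 * k) := by
            gcongr
            nlinarith
        _ ≤ _ := by rw [pow_succ]; linarith
    have h4 : 2 * (k : ℝ) ^ (k + 1) ≤ (2 * (k : ℝ) ^ (k + 1)) ^ (2 * k) := by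
      refine le_self_pow₀ ?_ (by omega)
      have : (1 : ℝ) ≤ (k : ℝ) ^ (k + 1) := one_le_pow₀ hkR
      linarith
    calc S ^ (2 * k) ≤ 2 * (k : ℝ) ^ (k + 1) * (N ^ (2 * k) / N ^ 2) := by
          rw [← mul_div_assoc, le_div_iff₀ (by positivity)]
          linarith
      _ ≤ _ := by gcongr

lemma polySum_prime_eq (p : ℕ) [Fact p.Prime] (f : ℤ[X]) :
    polySum p f = ∑ x : ZMod p, ZMod.stdAddChar ((f.map (Int.castRingHom (ZMod p))).eval x) := by
  rw [← sum_range_eq_sum_zmod p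
    (fun x => ZMod.stdAddChar ((f.map (Int.castRingHom (ZMod p))).eval x)), polySum]
  refine Finset.sum_congr rfl fun x _ => ?_
  have : ((f.map (Int.castRingHom (ZMod p))).eval ((x : ℕ) : ZMod p)) =
      ((f.eval (x : ℤ) : ℤ) : ZMod p) := by
    simp
  rw [this, ZMod.stdAddChar_coe, eC]
  congr 1
  push_cast
  ring

lemma norm_polySum_prime_le {k p : ℕ} (hp : p.Prime) {f : ℤ[X]} (hfk : f.natDegree ≤ k)
    [Fact p.Prime] (hf : (f.map (Int.castRingHom (ZMod p))).natDegree ≠ 0) :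
    ‖polySum p f‖ ≤ 2 * (k : ℝ) ^ (k + 1) * (p : ℝ) ^ (1 - 1 / (k : ℝ)) := by
  have hk1 : 1 ≤ k := by
    have := natDegree_map_le (f := Int.castRingHom (ZMod p)) (p := f)
    omega
  have hkR : (1 : ℝ) ≤ k := by exact_mod_cast hk1
  have hp1 : (1 : ℝ) ≤ p := by exact_mod_cast hp.one_lt.le
  by_cases hpk : p ≤ k
  · refine (norm_polySum_le p f).trans ?_
    have h1 : (1 : ℝ) ≤ (p : ℝ) ^ (1 - 1 / (k : ℝ)) := by
      apply Real.one_le_rpow hp1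
      rw [sub_nonneg, div_le_one (by linarith)]
      exact hkR
    have h2 : (k : ℝ) ≤ (k : ℝ) ^ (k + 1) := le_self_pow₀ hkR (by omega)
    calc (p : ℝ) ≤ k := by exact_mod_cast hpk
      _ ≤ 2 * (k : ℝ) ^ (k + 1) * 1 := by linarith
      _ ≤ _ := by gcongr
  · rw [polySum_prime_eq]
    have := mordell (ZMod.isPrimitive_stdAddChar p) (k := k) ?_ (Nat.one_le_iff_ne_zero.2 hf)
      (natDegree_map_le.trans hfk)
    · simpa [ZMod.card] using this
    · intro n hn hnk h0
      rw [ZMod.natCast_eq_zero_iff] at h0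
      exact absurd (Nat.le_of_dvd hn h0) (by omega)

lemma exists_eq_C_pow_mul {p : ℕ} (hp : p.Prime) {f : ℤ[X]} (hf : f ≠ 0) :
    ∃ (n : ℕ) (g : ℤ[X]), f = C ((p : ℤ) ^ n) * g ∧ g.map (Int.castRingHom (ZMod p)) ≠ 0 := by
  have hfin : FiniteMultiplicity (C (p : ℤ)) f := by
    refine FiniteMultiplicity.of_not_isUnit ?_ hf
    rw [isUnit_C]
    exact (Nat.prime_iff_prime_int.1 hp).not_isUnit
  obtain ⟨g, hg, hng⟩ := hfin.exists_eq_pow_mul_and_not_dvd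
  refine ⟨_, g, by rw [C_pow]; exact hg, fun h0 => hng ?_⟩
  rw [C_dvd_iff_dvd_coeff]
  intro i
  have := congrArg (fun r => r.coeff i) h0
  simpa [ZMod.intCast_zmod_eq_zero_iff_dvd] using this

lemma coeff_map_ne_zero_iff {p : ℕ} (f : ℤ[X]) (i : ℕ) :
    (f.map (Int.castRingHom (ZMod p))).coeff i ≠ 0 ↔ ¬ (p : ℤ) ∣ f.coeff i := by
  rw [coeff_map, eq_intCast, Ne, ZMod.intCast_zmod_eq_zero_iff_dvd]

lemma pow_dvd_of_dvd_mul {p : ℕ} (hp : p.Prime) {n : ℕ} {a b : ℤ} (ha : ¬ (p : ℤ) ∣ a)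
    (h : (p : ℤ) ^ n ∣ a * b) : (p : ℤ) ^ n ∣ b := by
  have : IsCoprime ((p : ℤ) ^ n) a :=
    IsCoprime.pow_left ((Prime.coprime_iff_not_dvd (Nat.prime_iff_prime_int.1 hp)).2 ha)
  exact this.dvd_of_dvd_mul_left h

lemma pow_le_of_derivative_eq {p k τ : ℕ} (hp : p.Prime) {f g : ℤ[X]} (hfk : f.natDegree ≤ k)
    (hf : (f.map (Int.castRingHom (ZMod p))).natDegree ≠ 0)
    (hfg : derivative f = C ((p : ℤ) ^ τ) * g) : p ^ τ ≤ k := by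
  set i := (f.map (Int.castRingHom (ZMod p))).natDegree with hi
  have hik : i ≤ k := natDegree_map_le.trans hfk
  have hpi : ¬ (p : ℤ) ∣ f.coeff i := by
    rw [← coeff_map_ne_zero_iff, hi]
    have : f.map (Int.castRingHom (ZMod p)) ≠ 0 := by intro h0; rw [h0] at hi; simp at hi; omega
    simpa using this
  have h1 := congrArg (fun r => r.coeff (i - 1)) hfg
  simp only [coeff_derivative, coeff_C_mul] at h1
  rw [Nat.sub_add_cancel (by omega)] at h1
  have h2 : (p : ℤ) ^ τ ∣ (((i - 1 : ℕ) : ℤ) + 1) := pow_dvd_of_dvd_mul hp hpi ⟨_, h1⟩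
  have h3 : (((i - 1 : ℕ) : ℤ) + 1) = (i : ℕ) := by omega
  rw [h3] at h2
  exact (Nat.le_of_dvd (by omega) (by exact_mod_cast h2)).trans hik

/-- The part of the exponential sum over a residue class modulo `p`. -/
def classSum (p l : ℕ) (f : ℤ[X]) (m : ℕ) : ℂ :=
  ∑ y ∈ range (p ^ (l - 1)), eC (((f.eval ((m : ℤ) + p * y) : ℤ) : ℝ) / (p ^ l : ℕ))

lemma classSum_eq_zero {p l τ m : ℕ} (hp : p.Prime) {f g : ℤ[X]} (hl : 2 * τ + 2 ≤ l)
    (hfg : derivative f = C ((p : ℤ) ^ τ) * g) (hm : ¬ (p : ℤ) ∣ g.eval (m : ℤ)) :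
    classSum p l f m = 0 := by
  have hp0 : 0 < p := hp.pos
  set G : ℤ → ℂ := fun y => eC (((f.eval ((m : ℤ) + p * y) : ℤ) : ℝ) / (p ^ l : ℕ)) with hG
  have hper : PeriodicMod (p ^ (l - 1)) G := by
    intro a b hab
    apply periodicMod_eC_eval (p ^ l) f
    rw [show (m : ℤ) + p * a - (m + p * b) = p * (a - b) by ring]
    have : ((p ^ l : ℕ) : ℤ) = p * ((p ^ (l - 1) : ℕ) : ℤ) := by
      rw [← Nat.cast_mul, ← pow_succ', Nat.sub_add_cancel (by omega)]
    rw [this]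
    exact mul_dvd_mul_left _ hab
  have hshift : ∀ y : ℤ, G ((p : ℤ) ^ (l - τ - 2) + 1 * y) =
      eC (((g.eval (m : ℤ) : ℤ) : ℝ) / p) * G y := by
    intro y
    set x : ℤ := m + p * y with hx
    have e1 : (m : ℤ) + p * ((p : ℤ) ^ (l - τ - 2) + 1 * y) = x + p ^ (l - τ - 1) := by
      rw [hx, show l - τ - 1 = (l - τ - 2) + 1 by omega, pow_succ']
      ring
    obtain ⟨κ, hκ⟩ := f.binomExpansion x ((p : ℤ) ^ (l - τ - 1))
    obtain ⟨w, hw⟩ := (sub_dvd_eval_sub x (m : ℤ) g)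
    have e2 : g.eval x = g.eval (m : ℤ) + p * (y * w) := by
      rw [hx] at hw ⊢
      linear_combination hw
    have e3 : (p : ℤ) ^ l = p ^ (l - 1) * p := by
      rw [← pow_succ, Nat.sub_add_cancel (by omega)]
    have e4 : (p : ℤ) ^ τ * p ^ (l - τ - 1) = p ^ (l - 1) := by
      rw [← pow_add]; congr 1; omega
    have e5 : ((p : ℤ) ^ (l - τ - 1)) ^ 2 = p ^ l * p ^ (l - 2 * τ - 2) := by
      rw [← pow_mul, ← pow_add]; congr 1; omega
    have e6 : f.eval (x + (p : ℤ) ^ (l - τ - 1)) - (f.eval x + p ^ (l - 1) * g.eval (m : ℤ)) =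
        p ^ l * (y * w + κ * p ^ (l - 2 * τ - 2)) := by
      rw [hκ, hfg, eval_mul, eval_C, e2]
      linear_combination (g.eval (m : ℤ) + p * (y * w)) * e4 + κ * e5 - (y * w) * e3
    rw [hG]
    dsimp only
    rw [e1, eC_div_congr (p ^ l) (n := f.eval x + p ^ (l - 1) * g.eval (m : ℤ)), mul_comm,
      ← eC_add]
    · congr 1
      have e7 : ((p ^ l : ℕ) : ℝ) = p ^ (l - 1) * p := by
        rw [← pow_succ, Nat.sub_add_cancel (by omega)]; push_cast; rfl
      have : (p : ℝ) ≠ 0 := by positivity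
      rw [e7]
      push_cast
      rw [← hx]
      field_simp
      ring
    · rw [e6]; push_cast; exact dvd_mul_right _ _
  have hsum := hper.sum_affine (by positivity) ((p : ℤ) ^ (l - τ - 2)) 1 isCoprime_one_left
  simp_rw [hshift] at hsum
  rw [← Finset.mul_sum] at hsum
  by_contra h0
  have h0' : ∑ y ∈ range (p ^ (l - 1)), G y ≠ 0 := h0
  exact hm ((eC_div_eq_one_iff p hp0 _).1 (mul_right_cancel₀ h0' (by rw [hsum, one_mul])))

lemma derivative_affineComp (f : ℤ[X]) (a b : ℤ) :
    derivative (affineComp f a b) = C a * affineComp (derivative f) a b := by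
  rw [affineComp, affineComp, derivative_comp, taylor_apply, taylor_apply, derivative_comp]
  simp

/-- Data of the reduction step at a root of `f'`. -/
lemma exists_reduction {p k τ m : ℕ} (hp : p.Prime) [Fact p.Prime] {f g : ℤ[X]}
    (hfk : f.natDegree ≤ k) (hf : (f.map (Int.castRingHom (ZMod p))).natDegree ≠ 0)
    (hfg : derivative f = C ((p : ℤ) ^ τ) * g) (hg : g.map (Int.castRingHom (ZMod p)) ≠ 0) :
    ∃ (σ τ' : ℕ) (h g' : ℤ[X]), 1 ≤ σ ∧ σ ≤ k ∧ h.natDegree ≤ k ∧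
      (h.map (Int.castRingHom (ZMod p))).natDegree ≠ 0 ∧
      derivative h = C ((p : ℤ) ^ τ') * g' ∧ g'.map (Int.castRingHom (ZMod p)) ≠ 0 ∧
      (g'.map (Int.castRingHom (ZMod p))).natDegree ≤
        (g.map (Int.castRingHom (ZMod p))).rootMultiplicity (m : ZMod p) ∧
      ∀ y : ℤ, f.eval ((m : ℤ) + p * y) = f.eval (m : ℤ) + p ^ σ * h.eval y := by
  set φ := Int.castRingHom (ZMod p) with hφ
  have hp0 : (p : ℤ) ≠ 0 := by exact_mod_cast hp.ne_zero
  have hpp := Nat.prime_iff_prime_int.1 hp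
  set F := affineComp f (p : ℤ) m - C (f.eval (m : ℤ)) with hF
  have hFc0 : F.coeff 0 = 0 := by
    rw [hF, coeff_sub, coeff_affineComp, taylor_coeff_zero, coeff_C_zero]; simp
  have hFc : ∀ i, i ≠ 0 → F.coeff i = (taylor (m : ℤ) f).coeff i * p ^ i := by
    intro i hi
    rw [hF, coeff_sub, coeff_affineComp, coeff_C, if_neg hi, sub_zero]
  have hmt : ∀ r : ℤ[X], (taylor (m : ℤ) r).map φ = taylor (m : ZMod p) (r.map φ) := by
    intro r
    rw [taylor_apply, taylor_apply, Polynomial.map_comp]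
    simp
  set d := (f.map φ).natDegree with hd
  have htd : ¬ (p : ℤ) ∣ (taylor (m : ℤ) f).coeff d := by
    rw [← coeff_map_ne_zero_iff, ← hφ, hmt, hd, ← natDegree_taylor (f.map φ) (m : ZMod p)]
    have : taylor (m : ZMod p) (f.map φ) ≠ 0 := by
      intro h0
      rw [← natDegree_taylor (f.map φ) (m : ZMod p), h0] at hd
      simp at hd; omega
    simpa using this
  have hF0 : F ≠ 0 := by
    intro h0
    have := hFc d hf
    rw [h0, coeff_zero] at this
    rcases mul_eq_zero.1 this.symm with h1 | h1
    · rw [h1] at htd; simp at htd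
    · exact pow_ne_zero _ hp0 h1
  obtain ⟨σ, h, hFh, hh⟩ := exists_eq_C_pow_mul hp hF0
  have hcoe : ∀ i, F.coeff i = (p : ℤ) ^ σ * h.coeff i := fun i => by rw [hFh, coeff_C_mul]
  have hh0 : h.coeff 0 = 0 := by
    have := hcoe 0
    rw [hFc0] at this
    exact (mul_eq_zero.1 this.symm).resolve_left (pow_ne_zero _ hp0)
  have hhd : (h.map φ).natDegree ≠ 0 := by
    intro h0
    apply hh
    rw [eq_C_of_natDegree_eq_zero h0, coeff_map, hh0]
    simp
  have hhd' : h.natDegree ≠ 0 := by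
    have := natDegree_map_le (f := φ) (p := h)
    omega
  have hh'0 : derivative h ≠ 0 := fun h0 => hhd' (derivative_eq_zero.1 h0)
  obtain ⟨τ', g', hhg, hg'⟩ := exists_eq_C_pow_mul hp hh'0
  have hσ1 : 1 ≤ σ := by
    by_contra h0
    apply hh
    ext i
    by_contra hne
    rw [coeff_zero] at hne
    rw [← Ne, coeff_map_ne_zero_iff] at hne
    apply hne
    have h1 := hcoe i
    rw [show σ = 0 by omega, pow_zero, one_mul] at h1
    rw [← h1]
    rcases eq_or_ne i 0 with rfl | hi
    · rw [hFc0]; exact dvd_zero _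
    · rw [hFc i hi]; exact dvd_mul_of_dvd_right (dvd_pow_self _ hi) _
  have hσd : σ ≤ d := by
    have h1 := hcoe d
    rw [hFc d hf] at h1
    have h2 : (p : ℤ) ^ σ ∣ p ^ d := pow_dvd_of_dvd_mul hp htd ⟨_, h1⟩
    exact (pow_dvd_pow_iff hp0 hpp.not_isUnit).1 h2
  have hrel : ∀ i, (p : ℤ) ^ (σ + τ') * g'.coeff i =
      (taylor (m : ℤ) g).coeff i * p ^ (1 + τ + i) := by
    intro i
    have h1 : derivative F = C (p : ℤ) * affineComp (derivative f) p m := by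
      rw [hF, derivative_sub, derivative_C, sub_zero, derivative_affineComp]
    rw [hFh, derivative_C_mul, hhg, hfg] at h1
    have h2 := congrArg (fun r => r.coeff i) h1
    simp only [coeff_C_mul, coeff_affineComp, taylor_mul, taylor_C] at h2
    rw [pow_add, mul_assoc, h2]
    ring
  set M := (g.map φ).rootMultiplicity (m : ZMod p) with hM
  have hcM : ¬ (p : ℤ) ∣ (taylor (m : ℤ) g).coeff M := by
    rw [← coeff_map_ne_zero_iff, ← hφ, hmt, hM, rootMultiplicity_eq_natTrailingDegree,
      ← taylor_apply]
    have h0 : taylor (m : ZMod p) (g.map φ) ≠ 0 := by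
      intro h0; exact hg (taylor_injective _ (by rw [h0, map_zero]))
    simpa [trailingCoeff] using (trailingCoeff_eq_zero (p := taylor (m : ZMod p) (g.map φ))).not.2 h0
  have hle : σ + τ' ≤ 1 + τ + M := by
    have h2 : (p : ℤ) ^ (σ + τ') ∣ p ^ (1 + τ + M) :=
      pow_dvd_of_dvd_mul hp hcM ⟨_, (hrel M).symm⟩
    exact (pow_dvd_pow_iff hp0 hpp.not_isUnit).1 h2
  refine ⟨σ, τ', h, g', hσ1, hσd.trans (natDegree_map_le.trans hfk), ?_, hhd, hhg, hg', ?_, ?_⟩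
  · have h1 : h.natDegree = F.natDegree := by
      rw [hFh, natDegree_C_mul (pow_ne_zero _ hp0)]
    rw [h1, hF]
    refine (natDegree_sub_le _ _).trans ?_
    simp only [natDegree_C, max_le_iff, zero_le, and_true]
    exact (natDegree_affineComp_le _ _ _).trans hfk
  · rw [natDegree_le_iff_coeff_eq_zero]
    intro i hi
    by_contra hne
    rw [← Ne, coeff_map_ne_zero_iff] at hne
    apply hne
    have h1 := hrel i
    rw [show 1 + τ + i = σ + τ' + ((1 + τ + i - (σ + τ') - 1) + 1) by omega, pow_add (p : ℤ) (σ + τ'),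
      mul_left_comm] at h1
    rw [mul_left_cancel₀ (pow_ne_zero _ hp0) h1, pow_succ, ← mul_assoc]
    exact dvd_mul_left _ _
  · intro y
    have h1 := congrArg (eval y) hFh
    rw [hF, eval_sub, eval_affineComp, eval_C, eval_mul, eval_C] at h1
    linarith

lemma norm_classSum_le {p l : ℕ} (f : ℤ[X]) (m : ℕ) : ‖classSum p l f m‖ ≤ (p : ℝ) ^ (l - 1) := by
  refine (norm_sum_le _ _).trans ?_
  simp [norm_eC]

lemma classSum_eq_of_reduction {p l σ m : ℕ} (hp : p.Prime) {f h : ℤ[X]} (hσ : 1 ≤ σ) (hl : σ < l)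
    (hfh : ∀ y : ℤ, f.eval ((m : ℤ) + p * y) = f.eval (m : ℤ) + p ^ σ * h.eval y) :
    ‖classSum p l f m‖ = (p : ℝ) ^ (σ - 1) * ‖polySum (p ^ (l - σ)) h‖ := by
  have hp0 : (p : ℝ) ≠ 0 := by exact_mod_cast hp.ne_zero
  have h1 : ∀ y : ℤ, eC (((f.eval ((m : ℤ) + p * y) : ℤ) : ℝ) / (p ^ l : ℕ)) =
      eC (((f.eval (m : ℤ) : ℤ) : ℝ) / (p ^ l : ℕ)) *
        eC (((h.eval y : ℤ) : ℝ) / (p ^ (l - σ) : ℕ)) := by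
    intro y
    rw [← eC_add, hfh]
    congr 1
    have : ((p ^ l : ℕ) : ℝ) = p ^ σ * (p ^ (l - σ) : ℕ) := by
      push_cast; rw [← pow_add]; congr 1; omega
    rw [this]
    push_cast
    field_simp
  have h2 := (periodicMod_eC_eval (p ^ (l - σ)) h).sum_mul (p ^ (σ - 1))
  rw [← pow_add, show σ - 1 + (l - σ) = l - 1 by omega] at h2
  rw [classSum]
  simp_rw [h1]
  rw [← Finset.mul_sum, norm_mul, norm_eC, one_mul, h2, norm_mul]
  simp [polySum]

lemma sum_rootMultiplicity (p : ℕ) [Fact p.Prime] (g : (ZMod p)[X]) :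
    ∑ m ∈ range p, g.rootMultiplicity (m : ZMod p) = Multiset.card g.roots := by
  rw [sum_range_eq_sum_zmod p (fun z => g.rootMultiplicity z)]
  simp_rw [← count_roots]
  exact Multiset.sum_count_eq_card fun a _ => Finset.mem_univ a

/-- **Hua's bound** for prime power moduli, in the form suited to induction. -/
lemma norm_polySum_prime_pow_aux {p k : ℕ} (hp : p.Prime) [Fact p.Prime] (l : ℕ) :
    ∀ (f g : ℤ[X]) (τ : ℕ), f.natDegree ≤ k →
      (f.map (Int.castRingHom (ZMod p))).natDegree ≠ 0 → derivative f = C ((p : ℤ) ^ τ) * g →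
      g.map (Int.castRingHom (ZMod p)) ≠ 0 →
      ‖polySum (p ^ l) f‖ ≤ 2 * (k : ℝ) ^ (k + 3) *
        (max 1 (Multiset.card (g.map (Int.castRingHom (ZMod p))).roots) : ℕ) *
          (p : ℝ) ^ (l * (1 - 1 / (k : ℝ))) := by
  induction l using Nat.strong_induction_on with
  | _ l ih =>
    intro f g τ hfk hf hfg hg
    have hk1 : 1 ≤ k := by
      have := natDegree_map_le (f := Int.castRingHom (ZMod p)) (p := f)
      omega
    have hkR : (1 : ℝ) ≤ k := by exact_mod_cast hk1
    have hp1 : (1 : ℝ) ≤ p := by exact_mod_cast hp.one_lt.le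
    have hp0 : (0 : ℝ) < p := by linarith
    set E : ℝ := 1 - 1 / (k : ℝ) with hE
    have hE0 : 0 ≤ E := by
      rw [hE, sub_nonneg, div_le_one (by linarith)]
      exact hkR
    set K : ℝ := 2 * (k : ℝ) ^ (k + 3) with hK
    have hK0 : 0 ≤ K := by positivity
    have hPE : ∀ n : ℕ, (1 : ℝ) ≤ (p : ℝ) ^ (n * E) := fun n =>
      Real.one_le_rpow hp1 (by positivity)
    rcases lt_or_ge l (2 * τ + 2) with hl | hl
    · set M : ℝ := ((max 1 (Multiset.card (g.map (Int.castRingHom (ZMod p))).roots) : ℕ) : ℝ)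
      have hM : (1 : ℝ) ≤ M := Nat.one_le_cast.2 (le_max_left _ _)
      have hred : ‖polySum (p ^ l) f‖ ≤ K * (p : ℝ) ^ (l * E) → ‖polySum (p ^ l) f‖ ≤
          K * M * (p : ℝ) ^ (l * E) := by
        intro h
        refine h.trans ?_
        gcongr
        nlinarith
      apply hred
      rcases Nat.eq_zero_or_pos τ with rfl | hτ
      · interval_cases l
        · refine (norm_polySum_le _ f).trans ?_
          have : (1 : ℝ) ≤ (k : ℝ) ^ (k + 3) := one_le_pow₀ hkR
          simp only [pow_zero, Nat.cast_one, Nat.cast_zero, zero_mul, Real.rpow_zero, mul_one]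
          linarith
        · rw [pow_one]
          refine (norm_polySum_prime_le hp hfk hf).trans ?_
          rw [Nat.cast_one, one_mul, hK]
          gcongr <;> first | exact hkR | omega
      · refine (norm_polySum_le _ f).trans ?_
        have h1 : p ^ τ ≤ k := pow_le_of_derivative_eq hp hfk hf hfg
        have h2 : p ^ l ≤ k ^ 3 := by
          calc p ^ l ≤ p ^ (τ * 3) := Nat.pow_le_pow_right hp.pos (by omega)
            _ = (p ^ τ) ^ 3 := pow_mul _ _ _
            _ ≤ k ^ 3 := Nat.pow_le_pow_left h1 3
        have h3 : (k : ℝ) ^ 3 ≤ (k : ℝ) ^ (k + 3) := pow_le_pow_right₀ hkR (by omega)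
        calc ((p ^ l : ℕ) : ℝ) ≤ (k : ℝ) ^ 3 := by exact_mod_cast h2
          _ ≤ K * 1 := by rw [hK]; nlinarith [pow_nonneg (by linarith : (0 : ℝ) ≤ k) 3]
          _ ≤ _ := by gcongr; exact hPE l
    · have hclass : ∀ m : ℕ, ‖classSum p l f m‖ ≤
          K * (p : ℝ) ^ (l * E) *
            ((g.map (Int.castRingHom (ZMod p))).rootMultiplicity (m : ZMod p) : ℕ) := by
        intro m
        by_cases hm : (p : ℤ) ∣ g.eval (m : ℤ)
        · have hroot : 1 ≤ (g.map (Int.castRingHom (ZMod p))).rootMultiplicity (m : ZMod p) := by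
            rw [Nat.one_le_iff_ne_zero, Ne, rootMultiplicity_eq_zero_iff]
            push Not
            refine ⟨?_, hg⟩
            have := eval_intCast_map (Int.castRingHom (ZMod p)) g (m : ℤ)
            rw [IsRoot.def]
            simp only [Int.cast_natCast, eq_intCast] at this
            rw [this, ZMod.intCast_zmod_eq_zero_iff_dvd]
            exact hm
          obtain ⟨σ, τ', h, g', hσ1, hσk, hhk, hh, hhg, hg', hdeg, hev⟩ :=
            exists_reduction (m := m) hp hfk hf hfg hg
          set R := (g.map (Int.castRingHom (ZMod p))).rootMultiplicity (m : ZMod p)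
          have hR : (1 : ℝ) ≤ R := by exact_mod_cast hroot
          have hK1 : 1 ≤ K := by
            have : (1 : ℝ) ≤ (k : ℝ) ^ (k + 3) := one_le_pow₀ hkR
            rw [hK]; linarith
          rcases le_or_gt l σ with hlσ | hlσ
          · refine (norm_classSum_le f m).trans ?_
            have h1 : (p : ℝ) ^ (l - 1) ≤ (p : ℝ) ^ (l * E) := by
              rw [← Real.rpow_natCast]
              apply Real.rpow_le_rpow_of_exponent_le hp1
              have hlk : (l : ℝ) ≤ k := by exact_mod_cast hlσ.trans hσk
              have : (l : ℝ) / k ≤ 1 := by rw [div_le_one (by linarith)]; exact hlk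
              rw [Nat.cast_sub (by omega), Nat.cast_one, hE]
              have e : (l : ℝ) * (1 - 1 / k) = l - l / k := by ring
              linarith
            calc (p : ℝ) ^ (l - 1) ≤ 1 * (p : ℝ) ^ (l * E) * 1 := by simpa using h1
              _ ≤ _ := by gcongr
          · rw [classSum_eq_of_reduction hp hσ1 hlσ hev]
            have h1 := ih (l - σ) (by omega) h g' τ' hhk hh hhg hg'
            have h2 : (max 1 (Multiset.card (g'.map (Int.castRingHom (ZMod p))).roots)) ≤ R :=
              max_le hroot ((card_roots' _).trans hdeg)
            have h3 : (p : ℝ) ^ (σ - 1) * (p : ℝ) ^ (((l - σ : ℕ) : ℝ) * E) ≤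
                (p : ℝ) ^ (l * E) := by
              rw [← Real.rpow_natCast, ← Real.rpow_add hp0]
              apply Real.rpow_le_rpow_of_exponent_le hp1
              have : (σ : ℝ) / k ≤ 1 := by
                rw [div_le_one (by linarith)]; exact_mod_cast hσk
              rw [Nat.cast_sub hσ1, Nat.cast_one, Nat.cast_sub hlσ.le, hE]
              have e : ((l : ℝ) - σ) * (1 - 1 / k) = l * (1 - 1 / k) - σ + σ / k := by ring
              linarith
            calc (p : ℝ) ^ (σ - 1) * ‖polySum (p ^ (l - σ)) h‖
                ≤ (p : ℝ) ^ (σ - 1) * (K * R * (p : ℝ) ^ (((l - σ : ℕ) : ℝ) * E)) := by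
                  gcongr
                  refine h1.trans ?_
                  gcongr
              _ = K * R * ((p : ℝ) ^ (σ - 1) * (p : ℝ) ^ (((l - σ : ℕ) : ℝ) * E)) := by ring
              _ ≤ K * R * (p : ℝ) ^ (l * E) := by gcongr
              _ = _ := by ring
        · rw [classSum_eq_zero hp hl hfg hm, norm_zero]
          positivity
      have hsplit : polySum (p ^ l) f = ∑ m ∈ range p, classSum p l f m := by
        have := sum_range_mul_split (fun x => eC (((f.eval x : ℤ) : ℝ) / (p ^ l : ℕ))) p (p ^ (l - 1))
        rw [← pow_succ', Nat.sub_add_cancel (by omega)] at this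
        exact this
      rw [hsplit]
      calc ‖∑ m ∈ range p, classSum p l f m‖ ≤ ∑ m ∈ range p, ‖classSum p l f m‖ := norm_sum_le _ _
        _ ≤ ∑ m ∈ range p, K * (p : ℝ) ^ (l * E) *
            ((g.map (Int.castRingHom (ZMod p))).rootMultiplicity (m : ZMod p) : ℕ) :=
          Finset.sum_le_sum fun m _ => hclass m
        _ = K * (p : ℝ) ^ (l * E) *
            (Multiset.card (g.map (Int.castRingHom (ZMod p))).roots : ℕ) := by
          rw [← Finset.mul_sum, ← Nat.cast_sum, sum_rootMultiplicity]
        _ ≤ K * (p : ℝ) ^ (l * E) *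
            (max 1 (Multiset.card (g.map (Int.castRingHom (ZMod p))).roots) : ℕ) := by
          gcongr
          exact le_max_right _ _
        _ = _ := by ring

lemma norm_polySum_prime_pow_le {p k : ℕ} (hp : p.Prime) (l : ℕ) {f : ℤ[X]}
    (hfk : f.natDegree ≤ k) (hf : (f.map (Int.castRingHom (ZMod p))).natDegree ≠ 0) :
    ‖polySum (p ^ l) f‖ ≤ 2 * (k : ℝ) ^ (k + 4) * ((p ^ l : ℕ) : ℝ) ^ (1 - 1 / (k : ℝ)) := by
  have : Fact p.Prime := ⟨hp⟩
  have hf' : f.natDegree ≠ 0 := by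
    have := natDegree_map_le (f := Int.castRingHom (ZMod p)) (p := f)
    omega
  have hk1 : 1 ≤ k := by omega
  have hd0 : derivative f ≠ 0 := fun h0 => hf' (derivative_eq_zero.1 h0)
  obtain ⟨τ, g, hfg, hg⟩ := exists_eq_C_pow_mul hp hd0
  refine (norm_polySum_prime_pow_aux hp l f g τ hfk hf hfg hg).trans ?_
  have hgk : g.natDegree ≤ k := by
    have h1 : (derivative f).natDegree = g.natDegree := by
      rw [hfg, natDegree_C_mul (pow_ne_zero _ (by exact_mod_cast hp.ne_zero))]
    rw [← h1]
    exact (natDegree_derivative_le f).trans (by omega)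
  have h2 : (max 1 (Multiset.card (g.map (Int.castRingHom (ZMod p))).roots)) ≤ k :=
    max_le hk1 ((card_roots' _).trans (natDegree_map_le.trans hgk))
  have h3 : (p : ℝ) ^ (l * (1 - 1 / (k : ℝ))) = ((p ^ l : ℕ) : ℝ) ^ (1 - 1 / (k : ℝ)) := by
    rw [Real.rpow_mul (by positivity), Real.rpow_natCast]
    push_cast
    rfl
  rw [h3, pow_succ (k : ℝ) (k + 3), ← mul_assoc (2 : ℝ)]
  gcongr

lemma natDegree_map_C_mul_ne_zero {p : ℕ} (hp : p.Prime) {f : ℤ[X]} {u : ℤ}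
    (hu : ¬ (p : ℤ) ∣ u) (hf : (f.map (Int.castRingHom (ZMod p))).natDegree ≠ 0) :
    ((C u * f).map (Int.castRingHom (ZMod p))).natDegree ≠ 0 := by
  have : Fact p.Prime := ⟨hp⟩
  rw [Polynomial.map_mul, map_C, natDegree_C_mul]
  · exact hf
  · rwa [eq_intCast, Ne, ZMod.intCast_zmod_eq_zero_iff_dvd]

lemma norm_polySum_le_primeFactors {k : ℕ} (hk : 1 ≤ k) {q : ℕ} (hq : 0 < q) {f : ℤ[X]}
    (hfk : f.natDegree ≤ k)
    (hf : ∀ p : ℕ, p.Prime → p ∣ q → (f.map (Int.castRingHom (ZMod p))).natDegree ≠ 0) :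
    ‖polySum q f‖ ≤ (2 * (k : ℝ) ^ (k + 4)) ^ (#q.primeFactors) * (q : ℝ) ^ (1 - 1 / (k : ℝ)) := by
  induction q using Nat.recOnPosPrimePosCoprime generalizing f with
  | prime_pow p n hp hn =>
    rw [Nat.primeFactors_prime_pow hn.ne' hp, card_singleton, pow_one]
    exact norm_polySum_prime_pow_le hp n hfk (hf p hp (dvd_pow_self _ hn.ne'))
  | zero => simp at hq
  | one => simpa using norm_polySum_le 1 f
  | coprime a b ha hb hab iha ihb =>
    obtain ⟨u, v, hu, hv, huv⟩ := polySum_mul a b (by omega) (by omega) hab f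
    have key : ∀ {d : ℕ} {w : ℤ}, IsCoprime w d → d ∣ a * b → ∀ p : ℕ, p.Prime → p ∣ d →
        ((C w * f).map (Int.castRingHom (ZMod p))).natDegree ≠ 0 := by
      intro d w hw hd p hp hpd
      refine natDegree_map_C_mul_ne_zero hp (fun h => ?_) (hf p hp (hpd.trans hd))
      have := hw.isUnit_of_dvd' h (Int.natCast_dvd_natCast.2 hpd)
      exact (Nat.prime_iff_prime_int.1 hp).not_isUnit this
    have h1 := iha (by omega) ((natDegree_C_mul_le u f).trans hfk) (key hu (dvd_mul_right _ _))
    have h2 := ihb (by omega) ((natDegree_C_mul_le v f).trans hfk) (key hv (dvd_mul_left _ _))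
    rw [huv, norm_mul, hab.primeFactors_mul, card_union_of_disjoint hab.disjoint_primeFactors,
      pow_add, Nat.cast_mul, Real.mul_rpow (by positivity) (by positivity)]
    refine (mul_le_mul h1 h2 (norm_nonneg _) (by positivity)).trans_eq ?_
    ring

lemma exists_pow_card_primeFactors_le {A : ℝ} (hA : 1 ≤ A) {ε : ℝ} (hε : 0 < ε) :
    ∃ K : ℝ, 0 < K ∧ ∀ q : ℕ, 0 < q → A ^ (#q.primeFactors) ≤ K * (q : ℝ) ^ ε := by
  set B : ℕ := ⌈A ^ (1 / ε)⌉₊ with hB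
  refine ⟨A ^ B, by positivity, fun q hq => ?_⟩
  have hp : ∀ p ∈ q.primeFactors, A ≤ (if p ≤ B then A else 1) * (p : ℝ) ^ ε := by
    intro p hp
    have hp1 : (1 : ℝ) ≤ p := by exact_mod_cast (Nat.prime_of_mem_primeFactors hp).one_le
    split_ifs with h
    · exact le_mul_of_one_le_right (by linarith) (Real.one_le_rpow hp1 hε.le)
    · rw [one_mul]
      have h1 : A ^ (1 / ε) ≤ p := (Nat.le_ceil _).trans (by exact_mod_cast (not_le.1 h).le)
      calc A = (A ^ (1 / ε)) ^ ε := by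
            rw [← Real.rpow_mul (by linarith), one_div_mul_cancel hε.ne', Real.rpow_one]
        _ ≤ _ := Real.rpow_le_rpow (by positivity) h1 hε.le
  calc A ^ (#q.primeFactors) = ∏ p ∈ q.primeFactors, A := by simp
    _ ≤ ∏ p ∈ q.primeFactors, (if p ≤ B then A else 1) * (p : ℝ) ^ ε :=
      prod_le_prod (fun _ _ => by linarith) hp
    _ = A ^ #{p ∈ q.primeFactors | p ≤ B} * ((∏ p ∈ q.primeFactors, p : ℕ) : ℝ) ^ ε := by
      rw [prod_mul_distrib, Nat.cast_prod, Real.finsetProd_rpow _ _ (fun _ _ => by positivity),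
        ← prod_filter, prod_const]
    _ ≤ A ^ B * (q : ℝ) ^ ε := by
      gcongr
      · calc _ ≤ #(Icc 1 B) := card_le_card fun p hp => by
              simp only [Finset.mem_filter, Nat.mem_primeFactors] at hp
              simpa using ⟨hp.1.1.one_le, hp.2⟩
          _ = B := by simp
      · exact Nat.le_of_dvd hq (Nat.prod_primeFactors_dvd q)

/-- Hua's bound for complete exponential sums. -/
lemma exists_norm_polySum_le {k : ℕ} (hk : 1 ≤ k) {ε : ℝ} (hε : 0 < ε) :
    ∃ K : ℝ, 0 < K ∧ ∀ (q : ℕ) (f : ℤ[X]), 0 < q → f.natDegree ≤ k →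
      (∀ p : ℕ, p.Prime → p ∣ q → (f.map (Int.castRingHom (ZMod p))).natDegree ≠ 0) →
      ‖polySum q f‖ ≤ K * (q : ℝ) ^ (1 - 1 / (k : ℝ) + ε) := by
  have hA : (1 : ℝ) ≤ 2 * (k : ℝ) ^ (k + 4) := by
    have : (1 : ℝ) ≤ (k : ℝ) ^ (k + 4) := one_le_pow₀ (by exact_mod_cast hk)
    linarith
  obtain ⟨K, hK0, hK⟩ := exists_pow_card_primeFactors_le hA hε
  refine ⟨K, hK0, fun q f hq hfk hf => (norm_polySum_le_primeFactors hk hq hfk hf).trans ?_⟩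
  rw [add_comm (1 - 1 / (k : ℝ)), Real.rpow_add (by positivity), ← mul_assoc]
  gcongr
  exact hK q hq

/-- Hua's bound, normalised by removing the common factor of `q` and the coefficients. -/
lemma exists_norm_inv_mul_polySum_le {k : ℕ} (hk : 1 ≤ k) {ε : ℝ} (hε : 0 < ε) :
    ∃ K : ℝ, 0 < K ∧ ∀ (q : ℕ) (f : ℤ[X]), 0 < q → f.natDegree ≤ k → f.coeff 0 = 0 →
      ∃ q' : ℕ, 0 < q' ∧ (∀ i, (q : ℤ) ∣ q' * f.coeff i) ∧
        ‖(q : ℂ)⁻¹ * polySum q f‖ ≤ K * (q' : ℝ) ^ (-(1 / (k : ℝ)) + ε) := by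
  obtain ⟨K, hK0, hK⟩ := exists_norm_polySum_le hk hε
  refine ⟨K, hK0, fun q f hq hfk hf0 => ?_⟩
  set d : ℕ := Nat.gcd q f.content.natAbs with hd
  have hd0 : 0 < d := Nat.gcd_pos_of_pos_left _ hq
  obtain ⟨q', hq'⟩ : d ∣ q := Nat.gcd_dvd_left _ _
  have hq'0 : 0 < q' := Nat.pos_of_ne_zero fun h => by simp [h] at hq'; omega
  have hdc : (d : ℤ) ∣ f.content := Int.natCast_dvd.2 (Nat.gcd_dvd_right _ _)
  obtain ⟨g, hg⟩ : C (d : ℤ) ∣ f := (dvd_content_iff_C_dvd).1 hdc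
  have hdz : (d : ℤ) ≠ 0 := by exact_mod_cast hd0.ne'
  have hgdeg : g.natDegree ≤ k := by
    rwa [hg, natDegree_C_mul hdz] at hfk
  have hg0 : g.coeff 0 = 0 := by
    rw [hg, coeff_C_mul] at hf0
    exact (mul_eq_zero.1 hf0).resolve_left hdz
  refine ⟨q', hq'0, fun i => ?_, ?_⟩
  · rw [hg, coeff_C_mul, hq']
    exact ⟨g.coeff i, by push_cast; ring⟩
  have hgp : ∀ p : ℕ, p.Prime → p ∣ q' →
      (g.map (Int.castRingHom (ZMod p))).natDegree ≠ 0 := by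
    intro p hp hpq h0
    have hpg : C (p : ℤ) ∣ g := by
      rw [C_dvd_iff_dvd_coeff]
      intro i
      rcases Nat.eq_zero_or_pos i with rfl | hi
      · simp [hg0]
      · by_contra hcon
        exact (coeff_map_ne_zero_iff g i).2 hcon (coeff_eq_zero_of_natDegree_lt (by omega))
    have h1 : ((d * p : ℕ) : ℤ) ∣ f.content := by
      rw [dvd_content_iff_C_dvd, hg, Nat.cast_mul, C_mul]
      exact mul_dvd_mul_left _ hpg
    have h2 : d * p ∣ d := Nat.dvd_gcd (hq' ▸ mul_dvd_mul_left d hpq) (Int.natCast_dvd.1 h1)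
    have := Nat.le_of_dvd hd0 h2
    have := hp.two_le
    nlinarith
  have hsum : polySum q f = d * polySum q' g := by
    rw [hq', polySum, polySum, ← (periodicMod_eC_eval q' g).sum_mul d]
    refine sum_congr rfl fun x _ => ?_
    congr 1
    rw [hg, eval_mul, eval_C]
    push_cast
    rw [mul_div_mul_left]
    exact_mod_cast hd0.ne'
  have hdc : (d : ℂ) ≠ 0 := by exact_mod_cast hd0.ne'
  have hqr : (0 : ℝ) < q' := by exact_mod_cast hq'0
  rw [hsum, hq', Nat.cast_mul, mul_inv, mul_mul_mul_comm, inv_mul_cancel₀ hdc, one_mul, norm_mul,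
    norm_inv, Complex.norm_natCast]
  calc (q' : ℝ)⁻¹ * ‖polySum q' g‖ ≤ (q' : ℝ)⁻¹ * (K * (q' : ℝ) ^ (1 - 1 / (k : ℝ) + ε)) := by
        gcongr
        exact hK q' g hq'0 hgdeg hgp
    _ = _ := by
      rw [mul_left_comm, ← Real.rpow_neg_one, ← Real.rpow_add hqr]
      congr 2
      ring

section System

variable {t : ℕ} {ν μ : Fin t → ℕ} {k : (l : Fin t) → Fin (ν l) → ℕ} {s : ℕ}

/-- The polynomial whose complete exponential sum is `S_j(q,a)`. -/
def systemPoly (k : (l : Fin t) → Fin (ν l) → ℕ) (c : EqIdx t ν μ → Fin s → ℤ)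
    (a : EqIdx t ν μ → ℤ) (j : Fin s) : ℤ[X] :=
  ∑ i : EqIdx t ν μ, C (c i j * a i) * X ^ deg t ν μ k i

/-- The linear form `Λ_{j,l,n}`. -/
def linForm (c : EqIdx t ν μ → Fin s → ℤ) (a : EqIdx t ν μ → ℤ) (j : Fin s)
    (l : Fin t) (n : Fin (ν l)) : ℤ :=
  ∑ m : Fin (μ l), c ⟨l, (n, m)⟩ j * a ⟨l, (n, m)⟩

lemma Sq_eq_polySum (c : EqIdx t ν μ → Fin s → ℤ) {q : ℕ} (hq : 0 < q) (a : EqIdx t ν μ → ℤ)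
    (j : Fin s) : Sq t ν μ k s c q a j = polySum q (systemPoly k c a j) := by
  have := (periodicMod_eC_eval q (systemPoly k c a j)).sum_affine hq 1 1 isCoprime_one_left
  rw [polySum, ← this, Sq]
  refine sum_nbij' (fun x => x - 1) (fun x => x + 1) ?_ ?_ ?_ ?_ ?_
  · intro x hx; simp at hx ⊢; omega
  · intro x hx; simp at hx ⊢; omega
  · intro x hx; simp at hx ⊢; omega
  · intro x hx; simp
  · intro x hx
    have hx1 : 1 ≤ x := (Finset.mem_Icc.1 hx).1
    congr 2
    simp [systemPoly, eval_finsetSum, Nat.cast_sub hx1]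

lemma natDegree_systemPoly_le (c : EqIdx t ν μ → Fin s → ℤ) (a : EqIdx t ν μ → ℤ) (j : Fin s) :
    (systemPoly k c a j).natDegree ≤ kmax t ν k := by
  refine natDegree_sum_le_of_forall_le _ _ fun i _ => (natDegree_C_mul_X_pow_le _ _).trans ?_
  exact Finset.le_sup (f := fun p : KIdx t ν => k p.1 p.2) (Finset.mem_univ ⟨i.1, i.2.1⟩)

lemma coeff_zero_systemPoly (hk : ∀ l n, 0 < k l n) (c : EqIdx t ν μ → Fin s → ℤ)
    (a : EqIdx t ν μ → ℤ) (j : Fin s) : (systemPoly k c a j).coeff 0 = 0 := by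
  rw [systemPoly, finsetSum_coeff]
  refine sum_eq_zero fun i _ => ?_
  rw [coeff_C_mul_X_pow, deg, if_neg (hk i.1 i.2.1).ne]

lemma coeff_systemPoly (hk : Function.Injective fun p : KIdx t ν => k p.1 p.2)
    (c : EqIdx t ν μ → Fin s → ℤ) (a : EqIdx t ν μ → ℤ) (j : Fin s) (l : Fin t)
    (n : Fin (ν l)) : (systemPoly k c a j).coeff (k l n) = linForm c a j l n := by
  rw [systemPoly, finsetSum_coeff, linForm, Fintype.sum_sigma, sum_eq_single l]
  · rw [Fintype.sum_prod_type, sum_eq_single n]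
    · refine sum_congr rfl fun m _ => ?_
      rw [coeff_C_mul_X_pow, deg, if_pos rfl]
    · intro n' _ hn'
      refine sum_eq_zero fun m _ => ?_
      rw [coeff_C_mul_X_pow, deg, if_neg]
      intro h
      have := @hk ⟨l, n⟩ ⟨l, n'⟩ h
      simp at this
      exact hn' this.symm
    · simp
  · intro l' _ hl'
    refine sum_eq_zero fun m _ => ?_
    rw [coeff_C_mul_X_pow, deg, if_neg]
    intro h
    have := @hk ⟨l, n⟩ ⟨l', m.1⟩ h
    exact hl' (Sigma.mk.inj this).1.symm
  · simp

lemma exists_norm_inv_mul_Sq_le (hgrp : GroupedDegrees t ν μ k) {ε : ℝ} (hε : 0 < ε) :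
    ∃ K : ℝ, 0 < K ∧ ∀ (c : EqIdx t ν μ → Fin s → ℤ) (q : ℕ) (a : EqIdx t ν μ → ℤ) (j : Fin s),
      0 < q → ∃ q' : ℕ, 0 < q' ∧ (∀ l n, (q : ℤ) ∣ q' * linForm c a j l n) ∧
        ‖(q : ℂ)⁻¹ * Sq t ν μ k s c q a j‖ ≤
          K * (q' : ℝ) ^ (-(1 / (kmax t ν k : ℝ)) + ε) := by
  obtain ⟨ht, hν, -, -, hk, hinj⟩ := hgrp
  have hk1 : 1 ≤ kmax t ν k := (hk ⟨0, ht⟩ ⟨0, hν _⟩).trans_le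
    (Finset.le_sup (f := fun p : KIdx t ν => k p.1 p.2) (Finset.mem_univ ⟨⟨0, ht⟩, ⟨0, hν _⟩⟩))
  obtain ⟨K, hK0, hK⟩ := exists_norm_inv_mul_polySum_le hk1 hε
  refine ⟨K, hK0, fun c q a j hq => ?_⟩
  obtain ⟨q', h0, h1, h2⟩ := hK q (systemPoly k c a j) hq (natDegree_systemPoly_le c a j)
    (coeff_zero_systemPoly hk c a j)
  refine ⟨q', h0, fun l n => ?_, ?_⟩
  · rw [← coeff_systemPoly hinj]
    exact h1 _
  · rwa [Sq_eq_polySum c hq]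

lemma mem_aSet {q : ℕ} {a : EqIdx t ν μ → ℤ} :
    a ∈ aSet t ν μ s q ↔ (∀ i, 1 ≤ a i ∧ a i ≤ q) ∧
      ∀ m : ℕ, ((m : ℤ) ∣ (q : ℤ) ∧ ∀ i, (m : ℤ) ∣ a i) → m = 1 := by
  simp only [aSet, Finset.mem_filter, Fintype.mem_piFinset, Finset.mem_Icc]

lemma dvd_of_forall_dvd_mul {q : ℕ} (hq : 0 < q) {a : EqIdx t ν μ → ℤ}
    (ha : a ∈ aSet t ν μ s q) {z : ℤ} (h : ∀ i, (q : ℤ) ∣ z * a i) : (q : ℤ) ∣ z := by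
  set g := Nat.gcd q z.natAbs with hg
  have hg0 : 0 < g := Nat.gcd_pos_of_pos_left _ hq
  obtain ⟨x, hx⟩ : g ∣ q := Nat.gcd_dvd_left _ _
  obtain ⟨y, hy⟩ : (g : ℤ) ∣ z := Int.natCast_dvd.2 (Nat.gcd_dvd_right _ _)
  have hcop : IsCoprime (x : ℤ) y := by
    rw [Int.isCoprime_iff_gcd_eq_one, Int.gcd, Int.natAbs_natCast]
    have : g * Nat.gcd x y.natAbs = g := by
      rw [← Nat.gcd_mul_left, ← hx]
      conv_rhs => rw [hg, hy, Int.natAbs_mul, Int.natAbs_natCast]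
    exact Nat.eq_of_mul_eq_mul_left hg0 (by omega)
  have hx1 : x = 1 := by
    refine (mem_aSet.1 ha).2 x ⟨?_, fun i => ?_⟩
    · rw [hx]; push_cast; exact dvd_mul_left _ _
    · refine hcop.dvd_of_dvd_mul_left ?_
      have := h i
      rw [hx, hy, Nat.cast_mul, mul_assoc] at this
      exact (mul_dvd_mul_iff_left (by exact_mod_cast hg0.ne')).1 this
  rw [hx, hx1, mul_one, hy]
  exact dvd_mul_right _ _

lemma dvd_det_mul_of_dvd_linForm (c : EqIdx t ν μ → Fin s → ℤ) (a : EqIdx t ν μ → ℤ) (l : Fin t)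
    (n : Fin (ν l)) (J : Fin (μ l) → Fin s) {z : ℤ} (h : ∀ m, z ∣ linForm c a (J m) l n)
    (m : Fin (μ l)) :
    z ∣ (Matrix.of fun m m' : Fin (μ l) => c ⟨l, (n, m)⟩ (J m')).det * a ⟨l, (n, m)⟩ := by
  set A : Matrix (Fin (μ l)) (Fin (μ l)) ℤ := Matrix.of fun m m' => c ⟨l, (n, m)⟩ (J m')
  have h1 : Matrix.vecMul (Matrix.vecMul (fun m => a ⟨l, (n, m)⟩) A) A.adjugate =
      A.det • fun m => a ⟨l, (n, m)⟩ := by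
    rw [Matrix.vecMul_vecMul, Matrix.mul_adjugate, Matrix.vecMul_smul, Matrix.vecMul_one]
  have h2 := congrFun h1 m
  rw [Pi.smul_apply, smul_eq_mul] at h2
  rw [← h2]
  change z ∣ ∑ m', Matrix.vecMul (fun m => a ⟨l, (n, m)⟩) A m' * A.adjugate m' m
  refine Finset.dvd_sum fun m' _ => dvd_mul_of_dvd_left ?_ _
  have : Matrix.vecMul (fun m => a ⟨l, (n, m)⟩) A m' = linForm c a (J m') l n := by
    simp [Matrix.vecMul, dotProduct, linForm, A, mul_comm]
  rw [this]
  exact h m'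

/-- The common bound for the coefficients of the linear forms. -/
def coeffBound (c : EqIdx t ν μ → Fin s → ℤ) : ℕ := 1 + ∑ i, ∑ j, (c i j).natAbs

lemma abs_linForm_le (c : EqIdx t ν μ → Fin s → ℤ) {q : ℕ} {a : EqIdx t ν μ → ℤ}
    (ha : a ∈ aSet t ν μ s q) (j : Fin s) (l : Fin t) (n : Fin (ν l)) :
    |linForm c a j l n| ≤ coeffBound c * q := by
  have ha' := (mem_aSet.1 ha).1
  calc |linForm c a j l n| ≤ ∑ m : Fin (μ l), |c ⟨l, (n, m)⟩ j * a ⟨l, (n, m)⟩| :=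
        abs_sum_le_sum_abs _ _
    _ ≤ ∑ m : Fin (μ l), (∑ j, ((c ⟨l, (n, m)⟩ j).natAbs : ℤ)) * q := by
      refine sum_le_sum fun m _ => ?_
      rw [abs_mul]
      have h1 := ha' ⟨l, (n, m)⟩
      gcongr
      · rw [Int.abs_eq_natAbs]
        exact single_le_sum (f := fun j => ((c ⟨l, (n, m)⟩ j).natAbs : ℤ))
          (fun _ _ => by positivity) (Finset.mem_univ j)
      · rw [abs_of_nonneg (by linarith)]
        exact h1.2
    _ = (∑ m : Fin (μ l), ∑ j, ((c ⟨l, (n, m)⟩ j).natAbs : ℤ)) * q := by rw [sum_mul]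
    _ ≤ (coeffBound c : ℤ) * q := by
      gcongr
      have h2 : ∑ m : Fin (μ l), ∑ j, (c ⟨l, (n, m)⟩ j).natAbs ≤ ∑ i, ∑ j, (c i j).natAbs := by
        rw [Fintype.sum_sigma]
        refine le_trans ?_ (single_le_sum (f := fun l : Fin t =>
          ∑ x : Fin (ν l) × Fin (μ l), ∑ j, (c ⟨l, x⟩ j).natAbs) (fun _ _ => Nat.zero_le _)
          (Finset.mem_univ l))
        rw [Fintype.sum_prod_type]
        exact single_le_sum (f := fun n : Fin (ν l) =>
          ∑ m : Fin (μ l), ∑ j, (c ⟨l, (n, m)⟩ j).natAbs) (fun _ _ => Nat.zero_le _)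
          (Finset.mem_univ n)
      have h3 : ∑ m : Fin (μ l), ∑ j, (c ⟨l, (n, m)⟩ j).natAbs ≤ coeffBound c := by
        rw [coeffBound]; omega
      exact_mod_cast h3

variable {M : ℕ} (hM : ∀ l, μ l ≤ M)

/-- The position of an equation within its interval, as an element of `Fin M`. -/
def eqPos (i : EqIdx t ν μ) : Fin M := Fin.castLE (hM i.1) i.2.2

/-- The number of `(q,a)` for which `q ∣ ρ_m Λ_{J m}` is at most a constant times `∏ ρ_m`. -/
lemma card_le_of_dvd_linForm {c : EqIdx t ν μ → Fin s → ℤ} (hc : HighlyNonSingular t ν μ s c)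
    (J : Fin M → Fin s) (hJ : Function.Injective J) (ρ : Fin M → ℕ) (hρ : ∀ m, 0 < ρ m)
    (E : Finset (Σ _ : ℕ, EqIdx t ν μ → ℤ))
    (hE : ∀ e ∈ E, 0 < e.1 ∧ e.2 ∈ aSet t ν μ s e.1 ∧
      ∀ m l n, (e.1 : ℤ) ∣ ρ m * linForm c e.2 (J m) l n) :
    #E ≤ ∏ i : EqIdx t ν μ, (3 * coeffBound c * ρ (eqPos hM i)) := by
  set B := coeffBound c with hB
  have hB1 : 1 ≤ B := by rw [hB, coeffBound]; omega
  set box : Finset (EqIdx t ν μ → ℤ) := Fintype.piFinset fun i =>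
    Icc (-((B * ρ (eqPos hM i) : ℕ) : ℤ)) ((B * ρ (eqPos hM i) : ℕ) : ℤ)
  have hbox : box.card ≤ ∏ i : EqIdx t ν μ, (3 * B * ρ (eqPos hM i)) := by
    rw [Fintype.card_piFinset]
    refine prod_le_prod' fun i _ => ?_
    have : 1 ≤ B * ρ (eqPos hM i) := Nat.one_le_iff_ne_zero.2
      (mul_ne_zero (by omega) (hρ _).ne')
    rw [Int.card_Icc, mul_assoc]
    omega
  refine le_trans ?_ hbox
  refine card_le_card_of_injOn (fun e i =>
    ρ (eqPos hM i) * linForm c e.2 (J (eqPos hM i)) i.1 i.2.1 / e.1) ?_ ?_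
  · intro e he
    obtain ⟨h1, h2, h3⟩ := hE e he
    simp only [box, Fintype.coe_piFinset, Set.mem_pi, Set.mem_univ, forall_true_left,
      Finset.coe_Icc, Set.mem_Icc]
    intro i
    rw [← abs_le]
    obtain ⟨x, hx⟩ := h3 (eqPos hM i) i.1 i.2.1
    have hez : (0 : ℤ) < e.1 := by exact_mod_cast h1
    rw [hx, Int.mul_ediv_cancel_left _ hez.ne']
    have h4 := abs_linForm_le c h2 (J (eqPos hM i)) i.1 i.2.1
    have h5 : (e.1 : ℤ) * |x| ≤ e.1 * ((B * ρ (eqPos hM i) : ℕ) : ℤ) := by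
      calc (e.1 : ℤ) * |x| = |(e.1 : ℤ) * x| := by rw [abs_mul, abs_of_pos hez]
        _ = ρ (eqPos hM i) * |linForm c e.2 (J (eqPos hM i)) i.1 i.2.1| := by
          rw [← hx, abs_mul, Nat.abs_cast]
        _ ≤ ρ (eqPos hM i) * (B * e.1) := by gcongr
        _ = _ := by push_cast; ring
    exact le_of_mul_le_mul_left h5 hez
  · intro e he e' he' hee
    obtain ⟨h1, h2, h3⟩ := hE e he
    obtain ⟨h1', h2', h3'⟩ := hE e' he'
    have hez : (0 : ℤ) < e.1 := by exact_mod_cast h1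
    have hez' : (0 : ℤ) < e'.1 := by exact_mod_cast h1'
    have key : ∀ i, (e'.1 : ℤ) * e.2 i = e.1 * e'.2 i := by
      rintro ⟨l, n, m⟩
      have hlin : ∀ m : Fin (μ l), (0 : ℤ) ∣
          linForm c (fun i => (e'.1 : ℤ) * e.2 i - e.1 * e'.2 i) (J (Fin.castLE (hM l) m)) l n := by
        intro m
        have h4 := congrFun hee ⟨l, (n, m)⟩
        simp only [eqPos] at h4
        set jj := Fin.castLE (hM l) m
        obtain ⟨x, hx⟩ := h3 jj l n
        obtain ⟨x', hx'⟩ := h3' jj l n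
        rw [hx, hx', Int.mul_ediv_cancel_left _ hez.ne', Int.mul_ediv_cancel_left _ hez'.ne'] at h4
        have hlf : linForm c (fun i => (e'.1 : ℤ) * e.2 i - e.1 * e'.2 i) (J jj) l n =
            e'.1 * linForm c e.2 (J jj) l n - e.1 * linForm c e'.2 (J jj) l n := by
          simp only [linForm, mul_sum, ← sum_sub_distrib]
          exact sum_congr rfl fun _ _ => by ring
        have hρ' : (ρ jj : ℤ) ≠ 0 := by exact_mod_cast (hρ jj).ne'
        rw [hlf, zero_dvd_iff]
        refine (mul_eq_zero.1 ?_).resolve_left hρ'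
        linear_combination (e'.1 : ℤ) * hx - e.1 * hx' + (e'.1 : ℤ) * e.1 * h4
      have h5 := dvd_det_mul_of_dvd_linForm c _ l n
        (fun m => J (Fin.castLE (hM l) m)) hlin m
      rw [zero_dvd_iff] at h5
      have h6 := (mul_eq_zero.1 h5).resolve_left (hc.2 l n (fun m => J (Fin.castLE (hM l) m))
        (hJ.comp (Fin.castLE_injective (hM l))))
      linarith
    have hq : e.1 = e'.1 := by
      refine Nat.dvd_antisymm ?_ ?_
      · exact Int.natCast_dvd_natCast.1
          (dvd_of_forall_dvd_mul h1 h2 fun i => ⟨e'.2 i, key i⟩)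
      · exact Int.natCast_dvd_natCast.1
          (dvd_of_forall_dvd_mul h1' h2' fun i => ⟨e.2 i, (key i).symm⟩)
    refine Sigma.ext hq (heq_of_eq (funext fun i => ?_))
    have := key i
    rw [hq] at this
    exact mul_left_cancel₀ hez'.ne' this

lemma exists_le_mul_prod {c : EqIdx t ν μ → Fin s → ℤ} (hc : HighlyNonSingular t ν μ s c)
    (J : Fin M → Fin s) (hJ : Function.Injective J) (hM : ∀ l, μ l ≤ M) :
    ∃ D : ℕ, 0 < D ∧ ∀ (ρ : Fin M → ℕ) (q : ℕ) (a : EqIdx t ν μ → ℤ), (∀ m, 0 < ρ m) → 0 < q →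
      a ∈ aSet t ν μ s q → (∀ m l n, (q : ℤ) ∣ ρ m * linForm c a (J m) l n) →
      q ≤ D * ∏ m, ρ m := by
  set dt : KIdx t ν → ℤ := fun p => (Matrix.of fun m m' : Fin (μ p.1) =>
    c ⟨p.1, (p.2, m)⟩ (J (Fin.castLE (hM p.1) m'))).det with hdt
  have hdt0 : ∏ p, dt p ≠ 0 := prod_ne_zero_iff.2 fun p _ =>
    hc.2 p.1 p.2 _ (hJ.comp (Fin.castLE_injective (hM p.1)))
  refine ⟨(∏ p, dt p).natAbs, Int.natAbs_pos.2 hdt0, fun ρ q a hρ hq ha h => ?_⟩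
  have hdvd : (q : ℤ) ∣ (∏ p, dt p) * ∏ m, (ρ m : ℤ) := by
    refine dvd_of_forall_dvd_mul hq ha ?_
    rintro ⟨l, n, m⟩
    have h1 : ∀ m : Fin (μ l), (q : ℤ) ∣
        linForm c (fun i => (∏ m, (ρ m : ℤ)) * a i) (J (Fin.castLE (hM l) m)) l n := by
      intro m
      have hlf : linForm c (fun i => (∏ m, (ρ m : ℤ)) * a i) (J (Fin.castLE (hM l) m)) l n =
          (∏ m, (ρ m : ℤ)) * linForm c a (J (Fin.castLE (hM l) m)) l n := by
        simp only [linForm, mul_sum]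
        exact sum_congr rfl fun _ _ => by ring
      rw [hlf]
      exact (h _ l n).trans (mul_dvd_mul_right (dvd_prod_of_mem (fun m => (ρ m : ℤ))
        (Finset.mem_univ _)) _)
    have h2 := dvd_det_mul_of_dvd_linForm c _ l n (fun m => J (Fin.castLE (hM l) m)) h1 m
    obtain ⟨w, hw⟩ : dt ⟨l, n⟩ ∣ ∏ p, dt p := dvd_prod_of_mem _ (Finset.mem_univ _)
    rw [hw]
    refine (h2.trans (Dvd.intro w ?_))
    simp only [hdt]
    ring
  have h3 := Int.natAbs_dvd_natAbs.2 hdvd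
  rw [Int.natAbs_natCast, Int.natAbs_mul] at h3
  have h4 : (∏ m, (ρ m : ℤ)).natAbs = ∏ m, ρ m := by
    rw [← Nat.cast_prod, Int.natAbs_natCast]
  rw [h4] at h3
  exact Nat.le_of_dvd (Nat.mul_pos (Int.natAbs_pos.2 hdt0) (prod_pos fun m _ => hρ m)) h3

/-- The product of the weights `ρ_m ^ (1 + n_m)`, where `n_m` counts the equations in
position `m`. -/
def weight (ρ : Fin M → ℕ) : ℝ := (∏ m, (ρ m : ℝ)) * ∏ i : EqIdx t ν μ, (ρ (eqPos hM i) : ℝ)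

lemma exists_sum_weight_le {c : EqIdx t ν μ → Fin s → ℤ} (hc : HighlyNonSingular t ν μ s c)
    (J : Fin M → Fin s) (hJ : Function.Injective J) {η : ℝ} (hη : 0 < η) :
    ∃ K : ℝ, ∀ (E : Finset (Σ _ : ℕ, EqIdx t ν μ → ℤ))
      (r : (Σ _ : ℕ, EqIdx t ν μ → ℤ) → Fin M → ℕ),
      (∀ e ∈ E, 0 < e.1 ∧ e.2 ∈ aSet t ν μ s e.1 ∧ (∀ m, 0 < r e m) ∧
        ∀ m l n, (e.1 : ℤ) ∣ r e m * linForm c e.2 (J m) l n) →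
      ∑ e ∈ E, (e.1 : ℝ) ^ (η / 2) * weight hM (ν := ν) (r e) ^ (-(1 + η)) ≤ K := by
  obtain ⟨D, hD0, hD⟩ := exists_le_mul_prod hc J hJ hM
  set Z : ℝ := ∑' x : ℕ, (x : ℝ) ^ (-(1 + η / 2)) with hZ
  have hZs : Summable fun x : ℕ => (x : ℝ) ^ (-(1 + η / 2)) :=
    Real.summable_nat_rpow.2 (by linarith)
  set A : ℝ := (3 * coeffBound c : ℝ) ^ Fintype.card (EqIdx t ν μ) with hA
  refine ⟨A * (D : ℝ) ^ (η / 2) * Z ^ M, fun E r hE => ?_⟩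
  set N : ℕ := E.sup fun e => univ.sup (r e) with hN
  set box : Finset (Fin M → ℕ) := Fintype.piFinset fun _ => Icc 1 N with hbox
  have hmaps : ∀ e ∈ E, r e ∈ box := fun e he => by
    rw [hbox, Fintype.mem_piFinset]
    intro m
    rw [Finset.mem_Icc]
    exact ⟨(hE e he).2.2.1 m, (Finset.le_sup (f := r e) (Finset.mem_univ m)).trans
      (Finset.le_sup (f := fun e => univ.sup (r e)) he)⟩
  rw [← sum_fiberwise_of_maps_to hmaps]
  have hfib : ∀ ρ ∈ box, ∑ e ∈ E with r e = ρ,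
      (e.1 : ℝ) ^ (η / 2) * weight hM (ν := ν) (r e) ^ (-(1 + η)) ≤
      A * (D : ℝ) ^ (η / 2) * ∏ m, (ρ m : ℝ) ^ (-(1 + η / 2)) := by
    intro ρ hρ
    have hρ1 : ∀ m, 1 ≤ ρ m := fun m => (Finset.mem_Icc.1 (Fintype.mem_piFinset.1 hρ m)).1
    have hρr : ∀ m, (1 : ℝ) ≤ ρ m := fun m => by exact_mod_cast hρ1 m
    set R : ℝ := ∏ m, (ρ m : ℝ) with hR
    set P : ℝ := ∏ i : EqIdx t ν μ, (ρ (eqPos hM i) : ℝ) with hP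
    have hR1 : 1 ≤ R := Finset.one_le_prod fun m _ => hρr m
    have hP1 : 1 ≤ P := Finset.one_le_prod fun i _ => hρr _
    have hcard := card_le_of_dvd_linForm hM hc J hJ ρ hρ1 {e ∈ E | r e = ρ} (by
      intro e he
      rw [Finset.mem_filter] at he
      obtain ⟨h1, h2, -, h4⟩ := hE e he.1
      exact ⟨h1, h2, he.2 ▸ h4⟩)
    have hcard' : (#{e ∈ E | r e = ρ} : ℝ) ≤ A * P := by
      refine (Nat.cast_le.2 hcard).trans_eq ?_
      push_cast
      rw [prod_mul_distrib, prod_const, Finset.card_univ]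
    have hW : weight hM (ν := ν) ρ = R * P := rfl
    have hterm : ∀ e ∈ ({e ∈ E | r e = ρ} : Finset _),
        (e.1 : ℝ) ^ (η / 2) * weight hM (ν := ν) (r e) ^ (-(1 + η)) ≤
        (D * R) ^ (η / 2) * (R * P) ^ (-(1 + η)) := by
      intro e he
      rw [Finset.mem_filter] at he
      obtain ⟨h1, h2, h3, h4⟩ := hE e he.1
      have h5 := hD (r e) e.1 e.2 h3 h1 h2 h4
      rw [he.2, hW]
      rw [he.2] at h5
      have h6 : (e.1 : ℝ) ≤ D * R := by
        rw [hR]; exact_mod_cast h5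
      gcongr
    calc _ ≤ #{e ∈ E | r e = ρ} • ((D * R) ^ (η / 2) * (R * P) ^ (-(1 + η))) :=
          sum_le_card_nsmul _ _ _ hterm
      _ ≤ A * P * ((D * R) ^ (η / 2) * (R * P) ^ (-(1 + η))) := by
        rw [nsmul_eq_mul]
        gcongr
      _ = A * (D : ℝ) ^ (η / 2) * (R ^ (-(1 + η / 2)) * P ^ (-η)) := by
        rw [Real.mul_rpow (by positivity) (by positivity),
          Real.mul_rpow (by positivity) (by positivity),
          show -(1 + η / 2) = η / 2 + -(1 + η) by ring, Real.rpow_add (by positivity),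
          show -η = 1 + -(1 + η) by ring, Real.rpow_add (by positivity), Real.rpow_one]
        ring_nf
      _ ≤ A * (D : ℝ) ^ (η / 2) * (R ^ (-(1 + η / 2)) * 1) := by
        gcongr
        exact Real.rpow_le_one_of_one_le_of_nonpos hP1 (by linarith)
      _ = _ := by
        rw [mul_one, hR, Real.finsetProd_rpow _ _ fun _ _ => by positivity]
  refine (sum_le_sum hfib).trans ?_
  rw [← mul_sum, hbox, ← prod_univ_sum (fun _ => Icc 1 N) fun _ x => (x : ℝ) ^ (-(1 + η / 2))]
  gcongr
  rw [prod_const, Finset.card_univ, Fintype.card_fin]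
  gcongr
  exact hZs.sum_le_tsum _ fun _ _ => by positivity

/-- A cyclic shift for which the weighted product is at most the average. -/
lemma exists_weight_pow_le [NeZero s] (hMs : M ≤ s) (x : Fin s → ℕ) (hx : ∀ j, 0 < x j) :
    ∃ σ : Fin s, weight hM (ν := ν) (fun m => x (Fin.castLE hMs m + σ)) ^ s ≤
      (∏ j, (x j : ℝ)) ^ (M + Fintype.card (EqIdx t ν μ)) := by
  by_contra! hcon
  set V := M + Fintype.card (EqIdx t ν μ)
  have hX : 0 < ∏ j, (x j : ℝ) := prod_pos fun j _ => by exact_mod_cast hx j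
  have h1 := Finset.prod_lt_prod_of_nonempty (s := (univ : Finset (Fin s)))
    (fun _ _ => pow_pos hX V) (fun σ _ => hcon σ) univ_nonempty
  have hshift : ∀ a : Fin s, ∏ σ, (x (a + σ) : ℝ) = ∏ j, (x j : ℝ) := fun a =>
    Equiv.prod_comp (Equiv.addLeft a) fun j => (x j : ℝ)
  refine h1.ne ?_
  rw [prod_const, Finset.card_univ, Fintype.card_fin, prod_pow]
  congr 1
  simp only [weight]
  rw [prod_mul_distrib, Finset.prod_comm, Finset.prod_comm (s := univ) (t := (univ : Finset (EqIdx t ν μ)))]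
  simp only [hshift, prod_const, Finset.card_univ, Fintype.card_fin, V, pow_add]

lemma sum_mu1_sub_mul (g : ℕ → ℕ) :
    ∑ h ∈ Icc 1 t, ((mu1 t μ h : ℤ) - mu1 t μ (h + 1)) * ∑ x ∈ range h, (g x : ℤ) =
      ∑ x ∈ range t, (g x : ℤ) * mu1 t μ (x + 1) := by
  have key : ∀ n : ℕ, ∑ h ∈ Icc 1 n, ((mu1 t μ h : ℤ) - mu1 t μ (h + 1)) *
      ∑ x ∈ range h, (g x : ℤ) + mu1 t μ (n + 1) * ∑ x ∈ range n, (g x : ℤ) =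
      ∑ x ∈ range n, (g x : ℤ) * mu1 t μ (x + 1) := by
    intro n
    induction n with
    | zero => simp
    | succ n ih =>
      rw [sum_Icc_succ_top (by omega), sum_range_succ _ n, sum_range_succ _ n, ← ih]
      ring
  have h0 : mu1 t μ (t + 1) = 0 := by simp [mu1]
  have := key t
  rw [h0] at this
  simpa using this

lemma varpi_eq_sum_range (h : ℕ) (hh : h ≤ t) :
    varpi t ν h = ∑ x ∈ range h, if hx : x < t then ν ⟨x, hx⟩ else 0 := by
  have h1 : varpi t ν h = ∑ x ∈ range t, if x < h then (if hx : x < t then ν ⟨x, hx⟩ else 0) else 0 := by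
    rw [varpi, Finset.sum_range]
    simp
  rw [h1, ← sum_filter]
  congr 1
  ext x
  simp
  omega

lemma card_eqIdx : Fintype.card (EqIdx t ν μ) = ∑ l, ν l * μ l := by
  simp [EqIdx, Fintype.card_sigma]

lemma sum_mu1_sub_mul_one_add_varpi (ht : 0 < t) :
    ∑ h ∈ Icc 1 t, ((mu1 t μ h : ℤ) - mu1 t μ (h + 1)) * (1 + varpi t ν h) =
      μ ⟨0, ht⟩ + Fintype.card (EqIdx t ν μ) := by
  set g : ℕ → ℕ := fun x => if hx : x < t then ν ⟨x, hx⟩ else 0 with hg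
  have h1 : ∀ h ∈ Icc 1 t, ((mu1 t μ h : ℤ) - mu1 t μ (h + 1)) * (1 + varpi t ν h) =
      ((mu1 t μ h : ℤ) - mu1 t μ (h + 1)) * ∑ x ∈ range h, ((if x = 0 then 1 else 0 : ℕ) : ℤ) +
      ((mu1 t μ h : ℤ) - mu1 t μ (h + 1)) * ∑ x ∈ range h, (g x : ℤ) := by
    intro h hh
    rw [Finset.mem_Icc] at hh
    rw [varpi_eq_sum_range h hh.2, ← mul_add]
    congr 2
    · have : 0 < h := hh.1
      push_cast
      rw [sum_ite_eq']
      simp [this]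
    · simp [hg]
  rw [sum_congr rfl h1, sum_add_distrib, sum_mu1_sub_mul, sum_mu1_sub_mul, card_eqIdx,
    Finset.sum_range, Finset.sum_range]
  congr 1
  · rw [sum_eq_single ⟨0, ht⟩]
    · simp [mu1, show 1 ≤ t from ht]
    · intro l _ hl
      have : (l : ℕ) ≠ 0 := fun h => hl (Fin.ext h)
      simp [this]
    · simp
  · push_cast
    refine sum_congr rfl fun l _ => ?_
    have : (l : ℕ) + 1 ≤ t := l.2
    simp [hg, mu1, this]

lemma mu1_succ_le (hμ : StrictAnti μ) {h : ℕ} (hh : 1 ≤ h) : mu1 t μ (h + 1) ≤ mu1 t μ h := by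
  unfold mu1
  split_ifs with h1 h2
  · exact hμ.antitone (Fin.mk_le_mk.2 (by omega))
  · omega
  · exact Nat.zero_le _
  · exact le_rfl

lemma kmax_mul_lt (hgrp : GroupedDegrees t ν μ k) (u : ℕ → ℕ)
    (huk : ∀ h ∈ Finset.Icc 1 t,
      (kmax t ν k : ℝ) * (1 + (varpi t ν h : ℝ)) ≤ 2 * (u h : ℝ))
    (hs : 2 * ∑ h ∈ Finset.Icc 1 t, (mu1 t μ h - mu1 t μ (h + 1)) * u h < s) :
    kmax t ν k * (μ ⟨0, hgrp.1⟩ + Fintype.card (EqIdx t ν μ)) < s := by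
  refine lt_of_le_of_lt ?_ hs
  have h1 := sum_mu1_sub_mul_one_add_varpi (ν := ν) (μ := μ) hgrp.1
  zify
  rw [← h1, mul_sum, mul_sum]
  refine sum_le_sum fun h hh => ?_
  have h2 := mu1_succ_le hgrp.2.2.2.1 (Finset.mem_Icc.1 hh).1
  have h3 : (kmax t ν k : ℤ) * (1 + varpi t ν h) ≤ 2 * u h := by exact_mod_cast huk h hh
  rw [Nat.cast_sub h2]
  have h4 : (0 : ℤ) ≤ (mu1 t μ h : ℤ) - mu1 t μ (h + 1) := by
    have : (mu1 t μ (h + 1) : ℤ) ≤ mu1 t μ h := by exact_mod_cast h2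
    linarith
  nlinarith [mul_le_mul_of_nonneg_left h3 h4]

lemma exists_sum_rpow_mul_norm_le (hgrp : GroupedDegrees t ν μ k)
    {c : EqIdx t ν μ → Fin s → ℤ} (hc : HighlyNonSingular t ν μ s c)
    (hs : kmax t ν k * (μ ⟨0, hgrp.1⟩ + Fintype.card (EqIdx t ν μ)) < s) :
    ∃ δ : ℝ, 0 < δ ∧ ∃ K : ℝ, ∀ Q : ℕ, ∑ q ∈ Icc 1 Q, (q : ℝ) ^ δ *
      ∑ a ∈ aSet t ν μ s q, ‖∏ j : Fin s, ((q : ℂ))⁻¹ * Sq t ν μ k s c q a j‖ ≤ K := by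
  obtain ⟨ht, hν, hμ, hanti, hk, hinj⟩ := id hgrp
  set M := μ ⟨0, ht⟩
  set V := M + Fintype.card (EqIdx t ν μ)
  set κ := kmax t ν k
  have hM : ∀ l, μ l ≤ M := fun l => hanti.antitone (Fin.mk_le_mk.2 (Nat.zero_le _))
  have hκ : 1 ≤ κ := (hk ⟨0, ht⟩ ⟨0, hν _⟩).trans_le
    (Finset.le_sup (f := fun p : KIdx t ν => k p.1 p.2) (Finset.mem_univ ⟨⟨0, ht⟩, ⟨0, hν _⟩⟩))
  have hV : 1 ≤ V := (hμ _).trans_le (Nat.le_add_right _ _)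
  have hMs : M ≤ s := by
    have : M ≤ V := Nat.le_add_right _ _
    nlinarith
  have : NeZero s := ⟨by omega⟩
  have hκr : (0 : ℝ) < κ := by exact_mod_cast hκ
  have hVr : (0 : ℝ) < V := by exact_mod_cast hV
  have hsr : (0 : ℝ) < s := by exact_mod_cast (NeZero.pos s)
  have hκV : (κ : ℝ) * V < s := by exact_mod_cast hs
  set η : ℝ := (s / (κ * V) - 1) / 2 with hη
  have hη0 : 0 < η := by
    have : 1 < s / (κ * V : ℝ) := (one_lt_div (by positivity)).2 hκV
    rw [hη]; linarith
  set ε : ℝ := η * V / s with hε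
  have hε0 : 0 < ε := by positivity
  have hθ : (-(1 / (κ : ℝ)) + ε) = -(1 + η) * V / s := by
    have : s / (κ * V : ℝ) = 1 + 2 * η := by rw [hη]; ring
    have h2 : 1 / (κ : ℝ) = (1 + 2 * η) * V / s := by rw [← this]; field_simp
    rw [h2, hε]; ring
  obtain ⟨K, hK0, hK⟩ := exists_norm_inv_mul_Sq_le (s := s) hgrp hε0
  set J : Fin s → Fin M → Fin s := fun σ m => Fin.castLE hMs m + σ
  have hJ : ∀ σ, Function.Injective (J σ) := fun σ =>
    (add_left_injective σ).comp (Fin.castLE_injective hMs)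
  choose K' hK' using fun σ => exists_sum_weight_le hM hc (J σ) (hJ σ) hη0
  have hex : ∀ e : Σ _ : ℕ, EqIdx t ν μ → ℤ, ∃ x : Fin s → ℕ, 0 < e.1 → ∀ j, 0 < x j ∧
      (∀ l n, (e.1 : ℤ) ∣ x j * linForm c e.2 j l n) ∧
      ‖(e.1 : ℂ)⁻¹ * Sq t ν μ k s c e.1 e.2 j‖ ≤ K * (x j : ℝ) ^ (-(1 / (κ : ℝ)) + ε) := by
    intro e
    by_cases he : 0 < e.1
    · choose x hx using fun j => hK c e.1 e.2 j he
      exact ⟨x, fun _ => hx⟩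
    · exact ⟨0, fun h => absurd h he⟩
  choose x hx using hex
  refine ⟨η / 2, by positivity, K ^ s * ∑ σ, K' σ, fun Q => ?_⟩
  simp only [mul_sum (s := aSet _ _ _ _ _)]
  rw [sum_sigma']
  set E := (Icc 1 Q).sigma fun q => aSet t ν μ s q
  have hE : ∀ e ∈ E, 0 < e.1 ∧ e.2 ∈ aSet t ν μ s e.1 := fun e he => by
    rw [Finset.mem_sigma, Finset.mem_Icc] at he
    exact ⟨he.1.1, he.2⟩
  have hterm : ∀ e ∈ E, ‖∏ j : Fin s, ((e.1 : ℂ))⁻¹ * Sq t ν μ k s c e.1 e.2 j‖ ≤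
      K ^ s * ∑ σ, weight hM (ν := ν) (fun m => x e (J σ m)) ^ (-(1 + η)) := by
    intro e he
    have hxe := hx e (hE e he).1
    have hw0 : ∀ σ, 0 < weight hM (ν := ν) (fun m => x e (J σ m)) := fun σ =>
      mul_pos (prod_pos fun m _ => by exact_mod_cast (hxe _).1)
        (prod_pos fun i _ => by exact_mod_cast (hxe _).1)
    have hX0 : 0 < ∏ j, (x e j : ℝ) := prod_pos fun j _ => by exact_mod_cast (hxe j).1
    obtain ⟨σ, hσ⟩ := exists_weight_pow_le (ν := ν) hM hMs (x e) fun j => (hxe j).1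
    rw [norm_prod]
    calc _ ≤ ∏ j, K * (x e j : ℝ) ^ (-(1 + η) * V / s) :=
          prod_le_prod (fun _ _ => norm_nonneg _) fun j _ => hθ ▸ (hxe j).2.2
      _ = K ^ s * (∏ j, (x e j : ℝ)) ^ (-(1 + η) * V / s) := by
        rw [prod_mul_distrib, prod_const, Finset.card_univ, Fintype.card_fin,
          Real.finsetProd_rpow _ _ fun _ _ => by positivity]
      _ = K ^ s * ((∏ j, (x e j : ℝ)) ^ V) ^ (-(1 + η) / s) := by
        rw [← Real.rpow_natCast _ V, ← Real.rpow_mul hX0.le]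
        congr 2
        ring
      _ ≤ K ^ s * (weight hM (ν := ν) (fun m => x e (J σ m)) ^ s) ^ (-(1 + η) / s) := by
        refine mul_le_mul_of_nonneg_left ?_ (by positivity)
        refine Real.rpow_le_rpow_of_nonpos (pow_pos (hw0 σ) s) hσ ?_
        exact div_nonpos_of_nonpos_of_nonneg (by linarith) hsr.le
      _ = K ^ s * weight hM (ν := ν) (fun m => x e (J σ m)) ^ (-(1 + η)) := by
        congr 1
        rw [← Real.rpow_natCast _ s, ← Real.rpow_mul (hw0 σ).le, mul_div_cancel₀ _ hsr.ne']
      _ ≤ _ := by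
        refine mul_le_mul_of_nonneg_left ?_ (by positivity)
        exact single_le_sum (f := fun σ =>
          weight hM (ν := ν) (fun m => x e (J σ m)) ^ (-(1 + η)))
          (fun σ _ => Real.rpow_nonneg (hw0 σ).le _) (Finset.mem_univ σ)
  calc _ ≤ ∑ e ∈ E, (e.1 : ℝ) ^ (η / 2) *
        (K ^ s * ∑ σ, weight hM (ν := ν) (fun m => x e (J σ m)) ^ (-(1 + η))) :=
        sum_le_sum fun e he => mul_le_mul_of_nonneg_left (hterm e he) (by positivity)
    _ = K ^ s * ∑ σ, ∑ e ∈ E, (e.1 : ℝ) ^ (η / 2) *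
        weight hM (ν := ν) (fun m => x e (J σ m)) ^ (-(1 + η)) := by
      rw [sum_comm, mul_sum]
      refine sum_congr rfl fun e _ => ?_
      rw [← mul_sum]
      ring
    _ ≤ _ := by
      refine mul_le_mul_of_nonneg_left (sum_le_sum fun σ _ => ?_) (by positivity)
      refine hK' σ E (fun e m => x e (J σ m)) fun e he => ?_
      have hxe := hx e (hE e he).1
      exact ⟨(hE e he).1, (hE e he).2, fun m => (hxe _).1, fun m l n => (hxe _).2.1 l n⟩

/-- Tail estimate from a weighted bound for the partial sums of the norms. -/
lemma summable_and_tail_le {f : ℕ → ℂ} {b : ℕ → ℝ} {δ K : ℝ} (hδ : 0 < δ) (hb0 : b 0 = 0)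
    (hfb : ∀ q, ‖f q‖ ≤ b q) (hK : ∀ Q : ℕ, ∑ q ∈ Icc 1 Q, (q : ℝ) ^ δ * b q ≤ K) :
    Summable b ∧ ∀ X : ℝ, 1 ≤ X →
      ‖(∑' q, f q) - ∑ q ∈ Icc 1 ⌊X⌋₊, f q‖ ≤ (∑' q : ℕ, (q : ℝ) ^ δ * b q) * X ^ (-δ) := by
  have hbn : ∀ q, 0 ≤ b q := fun q => (norm_nonneg _).trans (hfb q)
  have hwn : ∀ q : ℕ, 0 ≤ (q : ℝ) ^ δ * b q := fun q => mul_nonneg (by positivity) (hbn q)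
  have hw : Summable fun q : ℕ => (q : ℝ) ^ δ * b q := by
    refine summable_of_sum_range_le (c := K) hwn fun n => le_trans ?_ (hK n)
    calc ∑ q ∈ range n, (q : ℝ) ^ δ * b q ≤ ∑ q ∈ insert 0 (Icc 1 n), (q : ℝ) ^ δ * b q :=
          sum_le_sum_of_subset_of_nonneg (fun q hq => by
            simp only [Finset.mem_range] at hq
            simp only [Finset.mem_insert, Finset.mem_Icc]; omega) fun q _ _ => hwn q
      _ = _ := by rw [sum_insert (by simp), hb0]; simp
  have hble : ∀ q, b q ≤ (q : ℝ) ^ δ * b q := fun q => by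
    rcases Nat.eq_zero_or_pos q with rfl | hq
    · simp [hb0]
    · exact le_mul_of_one_le_left (hbn q)
        (Real.one_le_rpow (by exact_mod_cast hq) hδ.le)
  have hb : Summable b := hw.of_nonneg_of_le hbn hble
  have hf : Summable f := hb.of_norm_bounded hfb
  refine ⟨hb, fun X hX => ?_⟩
  have hX0 : 0 < X := by linarith
  have hf0 : f 0 = 0 := norm_le_zero_iff.1 (hb0 ▸ hfb 0)
  set g : ℕ → ℂ := fun q => if q ∈ Icc 1 ⌊X⌋₊ then 0 else f q with hg
  have hgle : ∀ q, ‖g q‖ ≤ ((q : ℝ) ^ δ * b q) * X ^ (-δ) := by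
    intro q
    have hnn : 0 ≤ ((q : ℝ) ^ δ * b q) * X ^ (-δ) := mul_nonneg (hwn q) (by positivity)
    by_cases hq : q ∈ Icc 1 ⌊X⌋₊
    · simpa only [hg, if_pos hq, norm_zero] using hnn
    rcases Nat.eq_zero_or_pos q with rfl | hq0
    · simpa [hg, hf0] using hnn
    simp only [hg, hq, if_false]
    have hXq : X ≤ q := by
      rw [Finset.mem_Icc, not_and, not_le] at hq
      exact ((Nat.floor_lt hX0.le).1 (hq hq0)).le
    have h1 : 1 ≤ (q : ℝ) ^ δ * X ^ (-δ) := by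
      rw [Real.rpow_neg hX0.le, ← div_eq_mul_inv, one_le_div (by positivity)]
      exact Real.rpow_le_rpow hX0.le hXq hδ.le
    calc ‖f q‖ ≤ b q := hfb q
      _ ≤ b q * ((q : ℝ) ^ δ * X ^ (-δ)) := le_mul_of_one_le_right (hbn q) h1
      _ = _ := by ring
  have heq : (∑' q, f q) - ∑ q ∈ Icc 1 ⌊X⌋₊, f q = ∑' q, g q := by
    have h1 : ∑ q ∈ Icc 1 ⌊X⌋₊, f q = ∑' q, if q ∈ Icc 1 ⌊X⌋₊ then f q else 0 := by
      rw [tsum_eq_sum (s := Icc 1 ⌊X⌋₊) fun q hq => if_neg hq]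
      exact sum_congr rfl fun q hq => (if_pos hq).symm
    have h2 : Summable fun q => if q ∈ Icc 1 ⌊X⌋₊ then f q else 0 :=
      summable_of_ne_finset_zero (s := Icc 1 ⌊X⌋₊) fun q hq => if_neg hq
    rw [h1, ← hf.tsum_sub h2]
    refine tsum_congr fun q => ?_
    by_cases hq : q ∈ Icc 1 ⌊X⌋₊
    · simp only [hg, if_pos hq, sub_self]
    · simp only [hg, if_neg hq, sub_zero]
  rw [heq, ← tsum_mul_right]
  exact tsum_of_norm_bounded (hw.mul_right _).hasSum hgle

lemma aSet_zero (hgrp : GroupedDegrees t ν μ k) : aSet t ν μ s 0 = ∅ := by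
  obtain ⟨ht, hν, hμ, -⟩ := hgrp
  rw [Finset.eq_empty_iff_forall_notMem]
  intro a ha
  have := (mem_aSet.1 ha).1 ⟨⟨0, ht⟩, (⟨0, hν _⟩, ⟨0, hμ _⟩)⟩
  push_cast at this
  linarith

end System

end

/-- Lemma 4.1 of Brandes–Parsell: if `s > 2s₀` with
`u_h ≥ (k/2)(1+ϖ_h)`, the singular series converges absolutely and
`𝔖 - 𝔖(X) ≪ X^{-δ}` for some `δ > 0`. -/
theorem statement12
    (t : ℕ) (ν μ : Fin t → ℕ) (k : (l : Fin t) → Fin (ν l) → ℕ)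
    (hgrp : GroupedDegrees t ν μ k)
    (s : ℕ) (c : EqIdx t ν μ → Fin s → ℤ)
    (hns : HighlyNonSingular t ν μ s c)
    (u : ℕ → ℕ) (hu : ∀ h ∈ Finset.Icc 1 t, 0 < u h)
    (huk : ∀ h ∈ Finset.Icc 1 t,
      (kmax t ν k : ℝ) * (1 + (varpi t ν h : ℝ)) ≤ 2 * (u h : ℝ))
    (hs : 2 * ∑ h ∈ Finset.Icc 1 t, (mu1 t μ h - mu1 t μ (h + 1)) * u h < s) :
    Summable (fun q : ℕ =>
      ∑ a ∈ aSet t ν μ s q, ‖∏ j : Fin s, ((q : ℂ))⁻¹ * Sq t ν μ k s c q a j‖) ∧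
    ∃ δ : ℝ, 0 < δ ∧ ∃ C : ℝ, ∀ X : ℝ, 1 ≤ X →
      ‖(∑' q : ℕ, ssTerm t ν μ k s c q) - ssTrunc t ν μ k s c X‖ ≤ C * X ^ (-δ) := by
  obtain ⟨δ, hδ, K, hK⟩ := exists_sum_rpow_mul_norm_le hgrp hns (kmax_mul_lt hgrp u huk hs)
  obtain ⟨h1, h2⟩ := summable_and_tail_le (f := ssTerm t ν μ k s c) hδ
    (by simp [aSet_zero hgrp]) (fun q => norm_sum_le _ _) hK
  exact ⟨h1, δ, hδ, _, h2⟩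

end
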